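/- Let Q_{12} and Q_{21} be real-analytic on [0,1], and let the boundary conditions be α_1 y_1(0) + α_2 y_2(0) + α_3 y_1(1) = 0 and y_2(1) = 0, with α_2 ≠ 0. Then the system of root functions of this boundary value problem is complete in L²([0,1];ℂ²) if and only if Q_{21} is not identically zero. -/

import Mathlib

open MeasureTheory Set Filter

noncomputable section

/-- The unit interval `[0,1]` as a subset of `ℝ`. -/
def I01 : Set ℝ := Set.Icc 0 1

/-- Lebesgue measure restricted to `[0,1]`. -/
def mu01 : MeasureTheory.Measure ℝ := MeasureTheory.volume.restrict I01

/-- `f ∈ W^n_1[0,1]`: the derivatives of `f` up to order `n-1` exist and are continuous on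
`[0,1]`, and the `(n-1)`-st derivative is absolutely continuous, i.e. an indefinite integral
of an integrable function (its a.e.-derivative `f⁽ⁿ⁾ ∈ L¹[0,1]`). -/
def MemW1 (n : ℕ) (f : ℝ → ℂ) : Prop :=
  ContDiffOn ℝ (n - 1 : ℕ) f I01 ∧
  ∃ g : ℝ → ℂ, MeasureTheory.IntegrableOn g I01 ∧
    ∀ x ∈ I01, iteratedDerivWithin (n - 1) f I01 x
      = iteratedDerivWithin (n - 1) f I01 0 + ∫ t in (0:ℝ)..x, g t

/-- `Jdet a j k` is the minor `J_{(j+1)(k+1)} = a_{1,j} a_{2,k} - a_{1,k} a_{2,j}` of the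
boundary coefficient matrix (`0`-based indices). -/
def Jdet (a : Fin 2 → Fin 4 → ℂ) (j k : Fin 4) : ℂ := a 0 j * a 1 k - a 0 k * a 1 j

/-- `y` satisfies the two-point boundary conditions `U_j(y) = 0`, `j = 1, 2`. -/
def SatisfiesBC (a : Fin 2 → Fin 4 → ℂ) (y : ℝ → ℂ × ℂ) : Prop :=
  ∀ j : Fin 2, a j 0 * (y 0).1 + a j 1 * (y 0).2 + a j 2 * (y 1).1 + a j 3 * (y 1).2 = 0

/-- `y` is absolutely continuous on `[0,1]` (an indefinite integral of an integrable `g`,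
which is then its a.e. derivative) and satisfies `-i B⁻¹ y' + Q y = rhs` a.e. on `[0,1]`. -/
def SolvesDirac (b₁ b₂ : ℝ) (Q12 Q21 : ℝ → ℂ) (y rhs : ℝ → ℂ × ℂ) : Prop :=
  ∃ g : ℝ → ℂ × ℂ, MeasureTheory.IntegrableOn g I01 ∧
    (∀ x ∈ I01, y x = y 0 + ∫ t in (0:ℝ)..x, g t) ∧
    (∀ᵐ x ∂mu01,
      (-Complex.I) * (b₁ : ℂ)⁻¹ * (g x).1 + Q12 x * (y x).2 = (rhs x).1 ∧
      (-Complex.I) * (b₂ : ℂ)⁻¹ * (g x).2 + Q21 x * (y x).1 = (rhs x).2)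

/-- `y` is a root function of the boundary value problem: a member of a chain
`ch 0, …, ch m` of absolutely continuous functions satisfying the boundary conditions,
with `ch 0 ≠ 0`, `L (ch 0) = λ • ch 0` a.e. and `L (ch j) = λ • ch j + ch (j-1)` a.e. -/
def IsRootFunction (b₁ b₂ : ℝ) (Q12 Q21 : ℝ → ℂ) (a : Fin 2 → Fin 4 → ℂ)
    (y : ℝ → ℂ × ℂ) : Prop :=
  ∃ (lam : ℂ) (m : ℕ) (ch : ℕ → ℝ → ℂ × ℂ),
    (∀ j ≤ m, SatisfiesBC a (ch j)) ∧
    (∃ x ∈ I01, ch 0 x ≠ 0) ∧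
    SolvesDirac b₁ b₂ Q12 Q21 (ch 0) (fun x => lam • ch 0 x) ∧
    (∀ j, 1 ≤ j → j ≤ m →
      SolvesDirac b₁ b₂ Q12 Q21 (ch j) (fun x => lam • ch j x + ch (j - 1) x)) ∧
    ∃ j ≤ m, y = ch j

/-- Completeness of the system of root functions in `L²([0,1]; ℂ²)`: the closed linear
span of (the `L²`-classes of) all root functions is the whole space. -/
def RootSystemComplete (b₁ b₂ : ℝ) (Q12 Q21 : ℝ → ℂ) (a : Fin 2 → Fin 4 → ℂ) : Prop :=
  (Submodule.span ℂ {g : MeasureTheory.Lp (ℂ × ℂ) 2 mu01 |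
    ∃ y : ℝ → ℂ × ℂ, IsRootFunction b₁ b₂ Q12 Q21 a y ∧
      (g : ℝ → ℂ × ℂ) =ᵐ[mu01] y}).topologicalClosure = ⊤

lemma setIntegral_ball_eq_integral_circleAverage {u : ℂ → ℝ} (hu : Continuous u) (z : ℂ) {r : ℝ}
    (hr : 0 ≤ r) :
    ∫ w in Metric.ball z r, u w = ∫ ρ in (0:ℝ)..r, 2 * Real.pi * ρ * Real.circleAverage u z ρ := by
  have h1 : ∫ w in Metric.ball z r, u w
      = ∫ w : ℂ, (Metric.ball z r).indicator u (z + w) := by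
    rw [integral_add_left_eq_self (fun w => (Metric.ball z r).indicator u w),
      integral_indicator Metric.isOpen_ball.measurableSet]
  rw [h1, ← Complex.integral_comp_polarCoord_symm]
  have h2 : ∫ p in polarCoord.target, p.1 • (Metric.ball z r).indicator u
        (z + Complex.polarCoord.symm p)
      = ∫ p in Ioo (0:ℝ) r ×ˢ Ioo (-Real.pi) Real.pi, p.1 * u (circleMap z p.1 p.2) := by
    have hsub : Ioo (0:ℝ) r ×ˢ Ioo (-Real.pi) Real.pi ⊆ polarCoord.target := by
      rw [polarCoord_target]; exact prod_mono Ioo_subset_Ioi_self le_rfl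
    rw [setIntegral_eq_of_subset_of_forall_sdiff_eq_zero
      polarCoord.open_target.measurableSet hsub]
    · refine setIntegral_congr_fun (measurableSet_Ioo.prod measurableSet_Ioo) ?_
      rintro ⟨ρ, θ⟩ ⟨hρ, hθ⟩
      simp only [mem_Ioo] at hρ
      have : z + Complex.polarCoord.symm (ρ, θ) = circleMap z ρ θ := by
        simp [circleMap, Complex.exp_mul_I]
      simp only [this, smul_eq_mul]
      rw [indicator_of_mem]
      simp [circleMap, abs_of_pos hρ.1, hρ.2]
    · rintro ⟨ρ, θ⟩ ⟨h3, h4⟩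
      rw [polarCoord_target] at h3
      have hρ : 0 < ρ := h3.1
      have hr' : r ≤ ρ := by
        by_contra hlt
        exact h4 ⟨⟨hρ, not_le.1 hlt⟩, h3.2⟩
      have : z + Complex.polarCoord.symm (ρ, θ) = circleMap z ρ θ := by
        simp [circleMap, Complex.exp_mul_I]
      simp only [this, smul_eq_mul]
      rw [indicator_of_notMem, mul_zero]
      simp [circleMap, abs_of_pos hρ, hr']
  rw [h2, Measure.volume_eq_prod, setIntegral_prod]
  · rw [intervalIntegral.integral_of_le hr, integral_Ioc_eq_integral_Ioo]
    refine setIntegral_congr_fun measurableSet_Ioo fun ρ _ => ?_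
    simp only
    rw [integral_const_mul, ← integral_Ioc_eq_integral_Ioo,
      ← intervalIntegral.integral_of_le (by linarith [Real.pi_pos]), Real.circleAverage,
      smul_eq_mul]
    have hper : Function.Periodic (fun θ => u (circleMap z ρ θ)) (2 * Real.pi) := fun θ => by
      simp only [periodic_circleMap z ρ θ]
    have := hper.intervalIntegral_add_eq (-Real.pi) 0
    rw [show -Real.pi + 2 * Real.pi = Real.pi by ring, zero_add] at this
    rw [this]
    have := Real.pi_pos
    field_simp
  · have hc : Continuous fun p : ℝ × ℝ => p.1 * u (circleMap z p.1 p.2) := by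
      unfold circleMap; fun_prop
    exact (hc.continuousOn.integrableOn_compact
      ((isCompact_Icc (a := (0:ℝ)) (b := r)).prod (isCompact_Icc (a := -Real.pi) (b := Real.pi)))).mono_set
      (prod_mono Ioo_subset_Icc_self Ioo_subset_Icc_self)

lemma log_norm_le_circleAverage {f : ℂ → ℂ} (hf : Differentiable ℂ f) {z : ℂ} (hz : f z ≠ 0)
    {r : ℝ} (hr : 0 < r) :
    Real.log ‖f z‖ ≤ Real.circleAverage (fun w => Real.log ‖f w‖) z r := by
  have hA : AnalyticOnNhd ℂ f (Metric.closedBall z |r|) := fun w _ => hf.analyticAt w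
  rw [hA.circleAverage_log_norm hr.ne' hz]
  refine le_add_of_nonneg_left (finsum_nonneg fun w => ?_)
  by_cases hw : w ∈ Metric.closedBall z |r|
  · refine mul_nonneg ?_ ?_
    · exact_mod_cast (MeromorphicOn.AnalyticOnNhd.divisor_nonneg hA) w
    · rw [Metric.mem_closedBall, dist_comm, dist_eq_norm, abs_of_pos hr] at hw
      rcases eq_or_ne ‖z - w‖ 0 with h0 | h0
      · simp [h0]
      · refine Real.log_nonneg ?_
        rw [← div_eq_mul_inv, le_div_iff₀ (lt_of_le_of_ne (norm_nonneg _) h0.symm), one_mul]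
        exact hw
  · rw [Function.locallyFinsuppWithin.apply_eq_zero_of_notMem _ hw]; simp

lemma posLog_norm_le_circleAverage {f : ℂ → ℂ} (hf : Differentiable ℂ f) (z : ℂ) {r : ℝ}
    (hr : 0 < r) : Real.posLog ‖f z‖ ≤ Real.circleAverage (fun w => Real.posLog ‖f w‖) z r := by
  rcases le_total ‖f z‖ 1 with h | h
  · rw [(Real.posLog_eq_zero_iff _).2 (by rwa [abs_norm])]
    exact Real.circleAverage_nonneg_of_nonneg fun w _ => Real.posLog_nonneg
  have hz : f z ≠ 0 := fun h0 => by simp [h0] at h; linarith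
  rw [Real.posLog_eq_log (by rwa [abs_norm])]
  refine (log_norm_le_circleAverage hf hz hr).trans ?_
  refine Real.circleAverage_mono ?_ ?_ fun w _ => le_max_right _ _
  · have hm : MeromorphicOn f (Metric.sphere z |r|) := fun w _ => (hf.analyticAt w).meromorphicAt
    exact MeromorphicOn.circleIntegrable_log_norm hm
  · exact (Real.continuous_posLog.comp hf.continuous.norm).continuousOn.circleIntegrable'

/-- The circle means of `log⁺ ‖E‖` for an entire quotient `E = F / D` of functions of exponential
type grow at most linearly. -/
lemma circleAverage_posLog_quotient_le {E F D : ℂ → ℂ} (hE : Differentiable ℂ E)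
    (hF : Differentiable ℂ F) (hD : Differentiable ℂ D) (hmul : ∀ z, E z * D z = F z)
    {C : ℝ} (hFC : ∀ z, ‖F z‖ ≤ Real.exp (C * (1 + ‖z‖)))
    (hDC : ∀ z, ‖D z‖ ≤ Real.exp (C * (1 + ‖z‖))) {c : ℂ} (hc : D c ≠ 0) (hC : 0 ≤ C)
    {r : ℝ} (hr : 0 < r) :
    Real.circleAverage (fun w => Real.posLog ‖E w‖) c r
      ≤ 2 * C * (1 + ‖c‖ + r) - Real.log ‖D c‖ := by
  have hAD : AnalyticOnNhd ℂ D univ := fun w _ => hD.analyticAt w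
  have hpos : ∀ {f : ℂ → ℂ}, Differentiable ℂ f →
      CircleIntegrable (fun w => Real.posLog ‖f w‖) c r := fun hf =>
    (Real.continuous_posLog.comp hf.continuous.norm).continuousOn.circleIntegrable'
  have hlogD : CircleIntegrable (fun w => Real.log ‖D w‖) c r :=
    (hAD.mono (subset_univ _)).meromorphicOn.circleIntegrable_log_norm
  have hbound : ∀ {f : ℂ → ℂ}, (∀ z, ‖f z‖ ≤ Real.exp (C * (1 + ‖z‖))) → Differentiable ℂ f →
      Real.circleAverage (fun w => Real.posLog ‖f w‖) c r ≤ C * (1 + ‖c‖ + r) := by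
    intro f hf hfd
    refine Real.circleAverage_mono_on_of_le_circle (hpos hfd) fun w hw => ?_
    have hw' : ‖w‖ ≤ ‖c‖ + r := by
      rw [mem_sphere_iff_norm, abs_of_pos hr] at hw
      calc ‖w‖ = ‖c + (w - c)‖ := by ring_nf
        _ ≤ _ := by rw [← hw]; exact norm_add_le _ _
    have h0 : 0 ≤ C * (1 + ‖c‖ + r) := by positivity
    refine max_le h0 ?_
    rcases eq_or_ne (f w) 0 with h | h
    · simp [h, h0]
    calc Real.log ‖f w‖ ≤ C * (1 + ‖w‖) :=
          (Real.log_le_iff_le_exp (norm_pos_iff.2 h)).2 (hf w)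
      _ ≤ _ := by exact mul_le_mul_of_nonneg_left (by linarith) hC
  set g : ℂ → ℝ := (fun w => Real.posLog ‖E w‖) + fun w => Real.log ‖D w‖
  have hg : CircleIntegrable g c r := (hpos hE).add hlogD
  have hcod : g =ᶠ[codiscreteWithin (Metric.sphere c |r|)] fun w => if D w = 0 then 0 else g w := by
    filter_upwards [codiscreteWithin_mono (subset_univ (Metric.sphere c |r|))
      (hAD.preimage_zero_mem_codiscrete hc)] with w hw
    have : D w ≠ 0 := hw
    simp [this]
  have h1 : Real.circleAverage g c r
      = Real.circleAverage (fun w => Real.posLog ‖E w‖) c r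
        + Real.circleAverage (fun w => Real.log ‖D w‖) c r :=
    Real.circleAverage_add (hpos hE) hlogD
  have h2 : Real.circleAverage g c r ≤ Real.circleAverage
      ((fun w => Real.posLog ‖F w‖) + fun w => Real.posLog ‖D w‖) c r := by
    rw [Real.circleAverage_congr_codiscreteWithin hcod hr.ne']
    refine Real.circleAverage_mono (hg.congr_codiscreteWithin hcod)
      ((hpos hF).add (hpos hD)) fun w _ => ?_
    simp only [Pi.add_apply]
    split_ifs with h
    · exact add_nonneg Real.posLog_nonneg Real.posLog_nonneg
    · have hD0 : 0 < ‖D w‖ := norm_pos_iff.2 h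
      simp only [g, Pi.add_apply]
      rcases le_total ‖E w‖ 1 with h3 | h3
      · rw [(Real.posLog_eq_zero_iff _).2 (by rwa [abs_norm]), zero_add]
        exact (le_max_right _ _).trans (le_add_of_nonneg_left Real.posLog_nonneg)
      · rw [Real.posLog_eq_log (by rwa [abs_norm]), ← Real.log_mul (by linarith) hD0.ne',
          ← norm_mul, hmul]
        exact (le_max_right _ _).trans (le_add_of_nonneg_right Real.posLog_nonneg)
  rw [Real.circleAverage_add (hpos hF) (hpos hD)] at h2
  have h3 := log_norm_le_circleAverage hD hc hr
  have h4 := hbound hFC hF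
  have h5 := hbound hDC hD
  linarith

/-- An entire quotient of functions of exponential type is of exponential type. -/
lemma exists_norm_quotient_le_exp {E F D : ℂ → ℂ} (hE : Differentiable ℂ E)
    (hF : Differentiable ℂ F) (hD : Differentiable ℂ D) (hmul : ∀ z, E z * D z = F z)
    {C : ℝ} (hFC : ∀ z, ‖F z‖ ≤ Real.exp (C * (1 + ‖z‖)))
    (hDC : ∀ z, ‖D z‖ ≤ Real.exp (C * (1 + ‖z‖))) {c : ℂ} (hc : D c ≠ 0) (hC : 0 ≤ C) :
    ∃ K, 0 ≤ K ∧ ∀ z, ‖E z‖ ≤ Real.exp (K * (1 + ‖z‖)) := by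
  set u : ℂ → ℝ := fun w => Real.posLog ‖E w‖ with hu_def
  have hu : Continuous u := Real.continuous_posLog.comp hE.continuous.norm
  have hu0 : ∀ w, 0 ≤ u w := fun w => Real.posLog_nonneg
  set A : ℝ := 2 * C + |Real.log ‖D c‖|
  have hA : 0 ≤ A := by positivity
  have hmean : ∀ r, 0 < r → Real.circleAverage u c r ≤ A * (1 + ‖c‖ + r) := fun r hr => by
    refine (circleAverage_posLog_quotient_le hE hF hD hmul hFC hDC hc hC hr).trans ?_
    have h1 := neg_abs_le (Real.log ‖D c‖)
    have h2 : 0 ≤ |Real.log ‖D c‖| * (‖c‖ + r) := by positivity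
    simp only [A]
    linarith
  have hInt : ∀ z r, Integrable u (volume.restrict (Metric.ball z r)) := fun z r =>
    (hu.continuousOn.integrableOn_compact (isCompact_closedBall z r)).mono_set
      Metric.ball_subset_closedBall
  have hpi := Real.pi_pos
  refine ⟨(2 + ‖c‖) ^ 2 * (A * (1 + ‖c‖ + (2 + ‖c‖))), by positivity, fun z => ?_⟩
  set ρ := 1 + ‖z‖
  have hρ : 1 ≤ ρ := by simp [ρ]
  set R := (2 + ‖c‖) * ρ
  have hR : 0 ≤ R := by positivity
  have hlow : Real.pi * ρ ^ 2 * u z ≤ ∫ w in Metric.ball z ρ, u w := by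
    rw [setIntegral_ball_eq_integral_circleAverage hu z (by linarith)]
    have : Real.pi * ρ ^ 2 * u z = ∫ t in (0:ℝ)..ρ, 2 * Real.pi * t * u z := by
      rw [intervalIntegral.integral_mul_const, intervalIntegral.integral_const_mul, integral_id]
      ring
    rw [this]
    refine intervalIntegral.integral_mono_on (by linarith) ?_ ?_ fun t ht => ?_
    · exact (by fun_prop : Continuous fun t : ℝ => 2 * Real.pi * t * u z).intervalIntegrable _ _
    · exact (by fun_prop : Continuous fun t : ℝ =>
        2 * Real.pi * t * Real.circleAverage u z t).intervalIntegrable _ _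
    · rcases ht.1.eq_or_lt with h | h
      · simp [← h]
      · have := posLog_norm_le_circleAverage hE z h
        gcongr
  have hmid : ∫ w in Metric.ball z ρ, u w ≤ ∫ w in Metric.ball c R, u w := by
    refine setIntegral_mono_set (hInt c R) (Eventually.of_forall hu0)
      (LE.le.eventuallyLE (Metric.ball_subset_ball' ?_))
    have h1 : dist z c ≤ ‖z‖ + ‖c‖ := by rw [dist_eq_norm]; exact norm_sub_le _ _
    have h2 : ‖c‖ ≤ ‖c‖ * ρ := le_mul_of_one_le_right (norm_nonneg _) hρ
    simp only [R, ρ] at *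
    linarith
  have hup : ∫ w in Metric.ball c R, u w ≤ Real.pi * R ^ 2 * (A * (1 + ‖c‖ + R)) := by
    rw [setIntegral_ball_eq_integral_circleAverage hu c hR]
    have : Real.pi * R ^ 2 * (A * (1 + ‖c‖ + R))
        = ∫ t in (0:ℝ)..R, 2 * Real.pi * t * (A * (1 + ‖c‖ + R)) := by
      rw [intervalIntegral.integral_mul_const, intervalIntegral.integral_const_mul, integral_id]
      ring
    rw [this]
    refine intervalIntegral.integral_mono_on hR ?_ ?_ fun t ht => ?_
    · exact (by fun_prop : Continuous fun t : ℝ =>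
        2 * Real.pi * t * Real.circleAverage u c t).intervalIntegrable _ _
    · exact (by fun_prop : Continuous fun t : ℝ =>
        2 * Real.pi * t * (A * (1 + ‖c‖ + R))).intervalIntegrable _ _
    · rcases ht.1.eq_or_lt with h | h
      · simp [← h]
      · have h1 := hmean t h
        have h2 : A * (1 + ‖c‖ + t) ≤ A * (1 + ‖c‖ + R) :=
          mul_le_mul_of_nonneg_left (by linarith [ht.2]) hA
        exact mul_le_mul_of_nonneg_left (h1.trans h2) (by positivity)
  have hchain := hlow.trans (hmid.trans hup)
  have hfin : u z ≤ (2 + ‖c‖) ^ 2 * (A * (1 + ‖c‖ + (2 + ‖c‖))) * ρ := by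
    have h1 : Real.pi * R ^ 2 * (A * (1 + ‖c‖ + R))
        = Real.pi * ρ ^ 2 * ((2 + ‖c‖) ^ 2 * (A * (1 + ‖c‖ + R))) := by simp only [R]; ring
    rw [h1] at hchain
    have h2 := le_of_mul_le_mul_left hchain (by positivity)
    refine h2.trans ?_
    have h3 : (1 + ‖c‖ + R) ≤ (1 + ‖c‖ + (2 + ‖c‖)) * ρ := by
      have : (1 + ‖c‖) ≤ (1 + ‖c‖) * ρ := le_mul_of_one_le_right (by positivity) hρ
      simp only [R]; linarith
    calc _ ≤ (2 + ‖c‖) ^ 2 * (A * ((1 + ‖c‖ + (2 + ‖c‖)) * ρ)) := by gcongr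
      _ = _ := by ring
  rcases eq_or_ne (E z) 0 with h | h
  · rw [h, norm_zero]; positivity
  · exact (Real.log_le_iff_le_exp (norm_pos_iff.2 h)).1 ((le_max_right _ _).trans hfin)

/-- If `F` vanishes at least to the order of `D` everywhere, then `F / D` is entire. -/
lemma exists_differentiable_quotient {F D : ℂ → ℂ} (hF : Differentiable ℂ F)
    (hD : Differentiable ℂ D) {c : ℂ} (hc : D c ≠ 0)
    (hord : ∀ z, analyticOrderAt D z ≤ analyticOrderAt F z) :
    ∃ E : ℂ → ℂ, Differentiable ℂ E ∧ ∀ z, E z * D z = F z := by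
  have hmer : MeromorphicOn (F / D) univ := fun z _ =>
    (hF.analyticAt z).meromorphicAt.div (hD.analyticAt z).meromorphicAt
  have hAD : AnalyticOnNhd ℂ D univ := fun w _ => hD.analyticAt w
  set E := toMeromorphicNFOn (F / D) univ
  have hE : Differentiable ℂ E := fun z => by
    refine AnalyticAt.differentiableAt ?_
    refine (MeromorphicNFAt.meromorphicOrderAt_nonneg_iff_analyticAt
      (meromorphicNFOn_toMeromorphicNFOn (F / D) univ (mem_univ z))).1 ?_
    rw [meromorphicOrderAt_toMeromorphicNFOn hmer (mem_univ z),
      meromorphicOrderAt_div (hF.analyticAt z).meromorphicAt (hD.analyticAt z).meromorphicAt,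
      (hF.analyticAt z).meromorphicOrderAt_eq, (hD.analyticAt z).meromorphicOrderAt_eq]
    have hfin : analyticOrderAt D z ≠ ⊤ := by
      intro h
      have h0 := hAD.eqOn_zero_of_preconnected_of_eventuallyEq_zero isPreconnected_univ
        (mem_univ z) (analyticOrderAt_eq_top.1 h)
      exact hc (h0 (mem_univ c))
    have h := hord z
    revert h hfin
    generalize analyticOrderAt D z = a
    generalize analyticOrderAt F z = b
    intro ha hab
    lift a to ℕ using ha
    induction b using ENat.recTopCoe with
    | top => simp
    | coe b =>
      have : a ≤ b := by exact_mod_cast hab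
      simp only [ENat.map_natCast]
      have h2 : (0 : ℤ) ≤ (b : ℤ) - (a : ℤ) := by omega
      exact WithTop.coe_le_coe.2 h2
  refine ⟨E, hE, fun z => ?_⟩
  have hev : ∀ᶠ w in nhdsWithin z {z}ᶜ, E w * D w = F w := by
    have hDne : ∀ᶠ w in nhdsWithin z {z}ᶜ, D w ≠ 0 := by
      rcases (hD.analyticAt z).eventually_eq_zero_or_eventually_ne_zero with h | h
      · exact absurd (hAD.eqOn_zero_of_preconnected_of_eventuallyEq_zero isPreconnected_univ
          (mem_univ z) h (mem_univ c)) hc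
      · exact h
    filter_upwards [hmer.toMeromorphicNFOn_eq_self_on_nhdsNE (mem_univ z), hDne] with w h1 h2
    have h3 : E w = F w / D w := h1
    rw [h3, div_mul_cancel₀ _ h2]
  have h1 := ((hE.continuous.mul hD.continuous).tendsto z).mono_left
    (nhdsWithin_le_nhds (s := {z}ᶜ))
  have h2 := (hF.continuous.tendsto z).mono_left (nhdsWithin_le_nhds (s := {z}ᶜ))
  exact tendsto_nhds_unique_of_eventuallyEq h1 h2 hev

/-- Phragmén–Lindelöf in a rotated quadrant: polynomial bounds on the two bounding rays propagate. -/
lemma norm_le_of_polynomial_bound_on_quadrant {m : ℂ → ℂ} (hm : Differentiable ℂ m) {K : ℝ}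
    (hexp : ∀ z, ‖m z‖ ≤ Real.exp (K * (1 + ‖z‖))) {C : ℝ} {N : ℕ} (hC : 0 ≤ C)
    (hray : ∀ z : ℂ, |z.re| = |z.im| → ‖m z‖ ≤ C * (1 + ‖z‖) ^ N) {a : ℂ}
    (ha : |a.re| = |a.im|) (ha2 : ‖a‖ ≤ 2) {z : ℂ} (hre : 0 ≤ z.re) (him : 0 ≤ z.im) :
    ‖m (a * z)‖ ≤ C * 2 ^ N * (2 + ‖z‖) ^ N := by
  set d : ℂ → ℂ := fun z => z + 1 + Complex.I
  have hd1 : ∀ w : ℂ, 0 ≤ w.re → 1 + w.re ≤ ‖d w‖ := fun w hw => by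
    refine le_trans ?_ (Complex.re_le_norm _)
    simp [d]; linarith
  have hd2 : ∀ w : ℂ, 0 ≤ w.im → 1 + w.im ≤ ‖d w‖ := fun w hw => by
    refine le_trans ?_ (Complex.im_le_norm _)
    simp [d]; linarith
  have hbdry : ∀ w : ℂ, 1 + ‖w‖ ≤ ‖d w‖ → |(a * w).re| = |(a * w).im| →
      ‖m (a * w) / d w ^ N‖ ≤ C * 2 ^ N := fun w h1 h2 => by
    have h0 : 0 < ‖d w‖ := by linarith [norm_nonneg w]
    rw [norm_div, norm_pow, div_le_iff₀ (by positivity), mul_assoc, ← mul_pow]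
    refine (hray _ h2).trans ?_
    have : 1 + ‖a * w‖ ≤ 2 * ‖d w‖ := by
      rw [norm_mul]
      nlinarith [norm_nonneg w, mul_le_mul_of_nonneg_right ha2 (norm_nonneg w)]
    gcongr
  have key : ‖m (a * z) / d z ^ N‖ ≤ C * 2 ^ N := by
    refine PhragmenLindelof.quadrant_I (f := fun z => m (a * z) / d z ^ N) ?_ ?_ ?_ ?_ hre him
    · refine DifferentiableOn.diffContOnCl fun w hw => ?_
      have hcl : closure (Ioi (0:ℝ) ×ℂ Ioi (0:ℝ)) ⊆ {w : ℂ | 0 ≤ w.re} :=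
        closure_minimal (fun w hw => show 0 ≤ w.re from (mem_Ioi.1 hw.1).le)
          (isClosed_le continuous_const Complex.continuous_re)
      have h0 : d w ≠ 0 := norm_pos_iff.1 (by
        have h1 := hd1 w (hcl hw)
        have h2 : 0 ≤ w.re := hcl hw
        linarith)
      have h1 : DifferentiableAt ℂ d w := by fun_prop
      exact ((hm.comp (differentiable_id.const_mul a)).differentiableAt.div (h1.pow N)
        (pow_ne_zero _ h0)).differentiableWithinAt
    · refine ⟨1, by norm_num, 2 * |K|, ?_⟩
      refine Asymptotics.IsBigO.of_bound (Real.exp |K|) ?_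
      refine eventually_inf_principal.2 (Eventually.of_forall fun w hw => ?_)
      have hw1 : 0 < w.re := mem_Ioi.1 hw.1
      have h0 : 1 ≤ ‖d w‖ := le_trans (by linarith) (hd1 w hw1.le)
      rw [norm_div, norm_pow, Real.norm_eq_abs, abs_of_pos (Real.exp_pos _), Real.rpow_one,
        ← Real.exp_add]
      refine (div_le_self (norm_nonneg _) (one_le_pow₀ h0)).trans ((hexp _).trans ?_)
      rw [Real.exp_le_exp, norm_mul]
      have h1 : K * (1 + ‖a‖ * ‖w‖) ≤ |K| * (1 + ‖a‖ * ‖w‖) :=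
        mul_le_mul_of_nonneg_right (le_abs_self K) (by positivity)
      have h2 : ‖a‖ * ‖w‖ ≤ 2 * ‖w‖ := mul_le_mul_of_nonneg_right ha2 (norm_nonneg _)
      nlinarith [abs_nonneg K, mul_le_mul_of_nonneg_left h2 (abs_nonneg K)]
    · intro x hx
      refine hbdry x ?_ ?_
      · have := hd1 x (by simpa using hx)
        simpa [abs_of_nonneg hx] using this
      · simp [abs_mul, ha]
    · intro x hx
      refine hbdry _ ?_ ?_
      · have := hd2 (x * Complex.I) (by simpa using hx)
        simpa [abs_of_nonneg hx] using this
      · simp [abs_mul, ha]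
  have h0 : 0 < ‖d z‖ := by linarith [hd1 z hre]
  rw [norm_div, norm_pow, div_le_iff₀ (by positivity)] at key
  refine key.trans ?_
  have : ‖d z‖ ≤ 2 + ‖z‖ := by
    refine (norm_add_le _ _).trans ?_
    have := norm_add_le z 1
    simp at this ⊢
    linarith
  gcongr

lemma exists_polynomial_bound_of_diagonal_bound {m : ℂ → ℂ} (hm : Differentiable ℂ m) {K : ℝ}
    (hexp : ∀ z, ‖m z‖ ≤ Real.exp (K * (1 + ‖z‖))) {C R : ℝ} {N : ℕ}
    (hray : ∀ z : ℂ, R ≤ ‖z‖ → |z.re| = |z.im| → ‖m z‖ ≤ C * (1 + ‖z‖) ^ N) :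
    ∃ C', ∀ z, ‖m z‖ ≤ C' * (1 + ‖z‖) ^ N := by
  obtain ⟨C₀, hC₀⟩ := (isCompact_closedBall (0:ℂ) R).exists_bound_of_continuousOn
    hm.continuous.continuousOn
  set M := max (max C C₀) 0
  have hM : 0 ≤ M := le_max_right _ _
  have hray' : ∀ z : ℂ, |z.re| = |z.im| → ‖m z‖ ≤ M * (1 + ‖z‖) ^ N := fun z hz => by
    have h1 : (1:ℝ) ≤ (1 + ‖z‖) ^ N := one_le_pow₀ (by linarith [norm_nonneg z])
    rcases le_total R ‖z‖ with h | h
    · refine (hray z h hz).trans ?_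
      gcongr
      exact (le_max_left _ _).trans (le_max_left _ _)
    · refine (hC₀ z (by simpa using h)).trans (le_trans ?_ (le_mul_of_one_le_right hM h1))
      exact (le_max_right _ _).trans (le_max_left _ _)
  refine ⟨M * 2 ^ N * 2 ^ N, fun w => ?_⟩
  have hquad : ∀ a : ℂ, a.re ^ 2 = 1 → a.im ^ 2 = 1 → 0 ≤ (w / a).re → 0 ≤ (w / a).im →
      ‖m w‖ ≤ M * 2 ^ N * 2 ^ N * (1 + ‖w‖) ^ N := fun a h1 h2 h3 h4 => by
    have hn : ‖a‖ ^ 2 = 2 := by rw [Complex.sq_norm, Complex.normSq_apply]; nlinarith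
    have hn1 : 1 ≤ ‖a‖ := by nlinarith [norm_nonneg a]
    have ha0 : a ≠ 0 := norm_pos_iff.1 (by linarith)
    have := norm_le_of_polynomial_bound_on_quadrant hm hexp hM hray' (a := a)
      (by rw [← sq_eq_sq_iff_abs_eq_abs, h1, h2]) (by nlinarith) h3 h4
    rw [mul_div_cancel₀ _ ha0] at this
    refine this.trans ?_
    rw [mul_assoc (M * 2 ^ N), ← mul_pow 2]
    have h5 : ‖w / a‖ ≤ ‖w‖ := by rw [norm_div]; exact div_le_self (norm_nonneg _) hn1
    have h6 : 2 + ‖w / a‖ ≤ 2 * (1 + ‖w‖) := by linarith [norm_nonneg w]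
    gcongr
  set s := w.re + w.im
  set t := w.im - w.re
  rcases le_total 0 s with hs | hs <;> rcases le_total 0 t with ht | ht
  · refine hquad ⟨1, 1⟩ (by norm_num) (by norm_num) ?_ ?_ <;>
      simp [Complex.div_re, Complex.div_im, Complex.normSq_apply, s, t] at hs ht ⊢ <;> linarith
  · refine hquad ⟨1, -1⟩ (by norm_num) (by norm_num) ?_ ?_ <;>
      simp [Complex.div_re, Complex.div_im, Complex.normSq_apply, s, t] at hs ht ⊢ <;> linarith
  · refine hquad ⟨-1, 1⟩ (by norm_num) (by norm_num) ?_ ?_ <;>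
      simp [Complex.div_re, Complex.div_im, Complex.normSq_apply, s, t] at hs ht ⊢ <;> linarith
  · refine hquad ⟨-1, -1⟩ (by norm_num) (by norm_num) ?_ ?_ <;>
      simp [Complex.div_re, Complex.div_im, Complex.normSq_apply, s, t] at hs ht ⊢ <;> linarith

lemma eq_zero_of_affine_recursion {m : ℕ → ℂ → ℂ} {c : ℕ → ℂ} (hm : ∀ n, Differentiable ℂ (m n))
    (hrec : ∀ n z, m (n + 1) z = z * m n z + c n) {N : ℕ}
    (hb : ∀ n, ∃ C, ∀ z, ‖m n z‖ ≤ C * (1 + ‖z‖) ^ N) (n : ℕ) : c n = 0 := by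
  induction N with
  | zero =>
    have hconst : ∀ n z w, m n z = m n w := fun n z w => by
      obtain ⟨C, hC⟩ := hb n
      refine (hm n).apply_eq_apply_of_bounded (isBounded_iff_forall_norm_le.2 ⟨C, ?_⟩) z w
      rintro _ ⟨z, rfl⟩
      simpa using hC z
    have h0 := hrec n 0
    have h1 := hrec n 1
    rw [hconst (n + 1) 1 0, h0, hconst n 1 0] at h1
    have h2 := hrec (n + 1) 0
    have h3 := hrec (n + 1) 1
    rw [hconst (n + 1 + 1) 1 0, h2, hconst (n + 1) 1 0] at h3
    have h4 : m (n + 1) 0 = 0 := by linear_combination -h3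
    rw [h4] at h0
    linear_combination -h0
  | succ N ih =>
    refine ih fun n => ?_
    obtain ⟨C, hC⟩ := hb n
    obtain ⟨C', hC'⟩ := hb (n + 1)
    have hC0 : 0 ≤ C := by simpa using (norm_nonneg _).trans (hC 0)
    have hC0' : 0 ≤ C' := by simpa using (norm_nonneg _).trans (hC' 0)
    refine ⟨2 * C + 2 * (C' + ‖c n‖), fun z => ?_⟩
    have h1 : (1:ℝ) ≤ (1 + ‖z‖) ^ N := one_le_pow₀ (by linarith [norm_nonneg z])
    have hcn := norm_nonneg (c n)
    rcases le_total ‖z‖ 1 with h | h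
    · refine (hC z).trans ?_
      rw [pow_succ]
      have h2 : (1 + ‖z‖) ^ N * (1 + ‖z‖) ≤ (1 + ‖z‖) ^ N * 2 := by gcongr; linarith
      have h3 := mul_le_mul_of_nonneg_left h2 hC0
      have h4 : 0 ≤ 2 * (C' + ‖c n‖) * (1 + ‖z‖) ^ N := by positivity
      nlinarith
    · have h2 : ‖z‖ * ‖m n z‖ ≤ C' * (1 + ‖z‖) ^ (N + 1) + ‖c n‖ := by
        rw [← norm_mul, show z * m n z = m (n + 1) z - c n by rw [hrec]; ring]
        exact (norm_sub_le _ _).trans (by linarith [hC' z])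
      have h3 : (1 + ‖z‖) ^ (N + 1) ≤ 2 * ‖z‖ * (1 + ‖z‖) ^ N := by
        rw [pow_succ, mul_comm]; gcongr; linarith
      have h4 : ‖c n‖ ≤ ‖c n‖ * (2 * ‖z‖ * (1 + ‖z‖) ^ N) :=
        le_mul_of_one_le_right hcn (by nlinarith)
      have h5 : ‖z‖ * ‖m n z‖ ≤ ‖z‖ * (2 * (C' + ‖c n‖) * (1 + ‖z‖) ^ N) := by
        have := mul_le_mul_of_nonneg_left h3 hC0'
        nlinarith
      have h6 := le_of_mul_le_mul_left h5 (by linarith)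
      have : 0 ≤ 2 * C * (1 + ‖z‖) ^ N := by positivity
      nlinarith

section

lemma norm_sub_exp_mul_le_of_hasDerivWithinAt {β c D : ℝ} {z : ℂ} {v : ℝ → ℂ} {t : ℝ}
    (hc : 0 < c) (hβ : 2 * c ≤ β) (hz : 0 < z.re) (ht : t ∈ Icc (0:ℝ) 1)
    (hv : ∀ s ∈ Icc t 1, ∃ f : ℂ, ‖f‖ ≤ D * Real.exp (c * z.re * (s - t)) ∧
      HasDerivWithinAt v (β * z * v s + f) (Icc 0 1) s) :
    ‖v t - Complex.exp (-(β * z * (1 - t))) * v 1‖ ≤ D / (c * z.re) := by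
  have hcz : 0 < c * z.re := mul_pos hc hz
  have hv' : ∀ s, ∃ f : ℂ, s ∈ Icc t 1 → ‖f‖ ≤ D * Real.exp (c * z.re * (s - t)) ∧
      HasDerivWithinAt v (β * z * v s + f) (Icc 0 1) s := fun s => by
    by_cases hs : s ∈ Icc t 1
    · obtain ⟨f, hf⟩ := hv s hs
      exact ⟨f, fun _ => hf⟩
    · exact ⟨0, fun h => absurd h hs⟩
  choose f hf using hv'
  set φ : ℝ → ℂ := fun s => Complex.exp (-(β * z * (s - t))) * v s
  have hφ : ∀ s ∈ Icc t 1, HasDerivWithinAt φ (Complex.exp (-(β * z * (s - t))) * f s)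
      (Icc t 1) s := fun s hs => by
    have h1 : HasDerivAt (fun s : ℝ => -(β * z * ((s:ℂ) - t))) (-(β * z * 1)) s :=
      (((Complex.ofRealCLM.hasDerivAt (x := s)).sub_const (t:ℂ)).const_mul (β * z)).neg
    have h2 := (h1.cexp.hasDerivWithinAt (s := Icc t 1)).mul
      ((hf s hs).2.mono (Icc_subset_Icc_left ht.1))
    exact h2.congr_deriv (by ring)
  have key := image_norm_le_of_norm_deriv_right_le_deriv_boundary
    (f := fun s => φ s - φ t) (f' := fun s => Complex.exp (-(β * z * (s - t))) * f s)
    (B := fun s => D / (c * z.re) * (1 - Real.exp (-(c * z.re * (s - t)))))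
    (B' := fun s => D * Real.exp (-(c * z.re * (s - t))))
    (a := t) (b := 1)
    (fun s hs => ((hφ s hs).sub_const _).continuousWithinAt)
    (fun s hs => ((hφ s (Ico_subset_Icc_self hs)).sub_const _).mono_of_mem_nhdsWithin
      (Icc_mem_nhdsGE_of_mem hs)) (by simp)
    (fun s => by
      have h1 : HasDerivAt (fun s : ℝ => -(c * z.re * (s - t))) (-(c * z.re * 1)) s :=
        (((hasDerivAt_id s).sub_const t).const_mul (c * z.re)).neg
      refine ((h1.exp.const_sub 1).const_mul (D / (c * z.re))).congr_deriv ?_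
      field_simp)
    (fun s hs => by
      have h1 := (hf s (Ico_subset_Icc_self hs)).1
      have h2 : 0 ≤ s - t := by linarith [hs.1]
      rw [norm_mul, Complex.norm_exp]
      have h3 : (-(β * z * ((s:ℂ) - t))).re = -(β * z.re * (s - t)) := by
        rw [← Complex.ofReal_sub]
        simp
      rw [h3]
      calc _ ≤ Real.exp (-(2 * c * z.re * (s - t))) * (D * Real.exp (c * z.re * (s - t))) := by
            gcongr
        _ = _ := by
            rw [mul_left_comm, ← Real.exp_add]
            congr 2
            ring)
    (x := 1) ⟨ht.2, le_rfl⟩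
  have hD : 0 ≤ D := by
    have := (norm_nonneg _).trans (hf t ⟨le_rfl, ht.2⟩).1
    simpa using this
  rw [norm_sub_rev]
  have h4 : φ 1 - φ t = Complex.exp (-(β * z * (1 - t))) * v 1 - v t := by simp [φ]
  simp only [h4] at key
  refine key.trans (mul_le_of_le_one_right (by positivity) ?_)
  linarith [Real.exp_pos (-(c * z.re * (1 - t)))]

lemma HasDerivWithinAt.reflect_unitInterval {v : ℝ → ℂ} {v' : ℂ} {s : ℝ}
    (h : HasDerivWithinAt v v' (Icc 0 1) (1 - s)) :
    HasDerivWithinAt (fun x => v (1 - x)) (-v') (Icc 0 1) s := by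
  have h1 : HasDerivWithinAt (fun x : ℝ => 1 - x) (-1) (Icc 0 1) s :=
    ((hasDerivAt_id s).const_sub 1).hasDerivWithinAt
  have h2 := HasDerivWithinAt.scomp s h h1
    (fun x hx => ⟨by linarith [hx.2], by linarith [hx.1]⟩)
  simpa [Function.comp_def] using h2

lemma norm_sub_exp_mul_le_of_hasDerivWithinAt' {β c D : ℝ} {z : ℂ} {v : ℝ → ℂ} {t : ℝ}
    (hc : 0 < c) (hβ : 2 * c ≤ β) (hz : 0 < z.re) (ht : t ∈ Icc (0:ℝ) 1)
    (hv : ∀ s ∈ Icc 0 t, ∃ f : ℂ, ‖f‖ ≤ D * Real.exp (c * z.re * (t - s)) ∧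
      HasDerivWithinAt v (-(β * z * v s) + f) (Icc 0 1) s) :
    ‖v t - Complex.exp (-(β * z * t)) * v 0‖ ≤ D / (c * z.re) := by
  have := norm_sub_exp_mul_le_of_hasDerivWithinAt (v := fun x => v (1 - x)) (t := 1 - t) (D := D)
    hc hβ hz ⟨by linarith [ht.2], by linarith [ht.1]⟩ (fun s hs => by
      obtain ⟨f, h1, h2⟩ := hv (1 - s) ⟨by linarith [hs.2], by linarith [hs.1]⟩
      refine ⟨-f, ?_, h2.reflect_unitInterval.congr_deriv (by ring)⟩
      rw [norm_neg]
      convert h1 using 4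
      ring)
  simpa using this

/-- `u` solves `u₁' = β₁ z u₁ + q₁ u₂`, `u₂' = -β₂ z u₂ + q₂ u₁` on `[0,1]` up to an error of
size at most `H`. -/
structure ApproxSolution (β₁ β₂ : ℝ) (q₁ q₂ : ℝ → ℂ) (z : ℂ) (H : ℝ) (u₁ u₂ : ℝ → ℂ) : Prop where
  fst : ∀ x ∈ Icc (0:ℝ) 1, ∃ h : ℂ, ‖h‖ ≤ H ∧
    HasDerivWithinAt u₁ (β₁ * z * u₁ x + (q₁ x * u₂ x + h)) (Icc 0 1) x
  snd : ∀ x ∈ Icc (0:ℝ) 1, ∃ h : ℂ, ‖h‖ ≤ H ∧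
    HasDerivWithinAt u₂ (-(β₂ * z * u₂ x) + (q₂ x * u₁ x + h)) (Icc 0 1) x

lemma ApproxSolution.reflect {β₁ β₂ : ℝ} {q₁ q₂ : ℝ → ℂ} {z : ℂ} {H : ℝ} {u₁ u₂ : ℝ → ℂ}
    (h : ApproxSolution β₁ β₂ q₁ q₂ z H u₁ u₂) :
    ApproxSolution β₁ β₂ (fun x => -q₁ (1 - x)) (fun x => -q₂ (1 - x)) (-z) H
      (fun x => u₁ (1 - x)) (fun x => u₂ (1 - x)) where
  fst x hx := by
    obtain ⟨e, he, hd⟩ := h.fst (1 - x) ⟨by linarith [hx.2], by linarith [hx.1]⟩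
    exact ⟨-e, by rwa [norm_neg], hd.reflect_unitInterval.congr_deriv (by ring)⟩
  snd x hx := by
    obtain ⟨e, he, hd⟩ := h.snd (1 - x) ⟨by linarith [hx.2], by linarith [hx.1]⟩
    exact ⟨-e, by rwa [norm_neg], hd.reflect_unitInterval.congr_deriv (by ring)⟩

/-- The weight controlling solutions with boundary data `A = u₁(1)`, `B = u₂(0)`. -/
def expWeight (κ A B H t : ℝ) : ℝ :=
  A * Real.exp (-(κ * (1 - t))) + B * Real.exp (-(κ * t)) + H

lemma expWeight_le {κ A B H : ℝ} (hκ : 0 ≤ κ) (hA : 0 ≤ A) (hB : 0 ≤ B) (hH : 0 ≤ H) {s t r : ℝ}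
    (h1 : s - t ≤ r) (h2 : t - s ≤ r) (hr : 0 ≤ r) :
    expWeight κ A B H s ≤ expWeight κ A B H t * Real.exp (κ * r) := by
  unfold expWeight
  rw [add_mul, add_mul, mul_assoc, mul_assoc, ← Real.exp_add, ← Real.exp_add]
  have : 1 ≤ Real.exp (κ * r) := Real.one_le_exp (by positivity)
  gcongr
  · nlinarith
  · nlinarith
  · exact le_mul_of_one_le_right hH this

variable {β₁ β₂ c M : ℝ} {q₁ q₂ : ℝ → ℂ}

lemma ApproxSolution.bounds {z : ℂ} {H : ℝ} {u₁ u₂ : ℝ → ℂ}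
    (h : ApproxSolution β₁ β₂ q₁ q₂ z H u₁ u₂) (hc : 0 < c) (hβ₁ : 2 * c ≤ β₁) (hβ₂ : 2 * c ≤ β₂)
    (hq₁ : ∀ x ∈ Icc (0:ℝ) 1, ‖q₁ x‖ ≤ M) (hq₂ : ∀ x ∈ Icc (0:ℝ) 1, ‖q₂ x‖ ≤ M)
    (hH : 0 < H) (hz : 0 < z.re) (hM : 2 * M + 1 ≤ c * z.re) {t : ℝ} (ht : t ∈ Icc (0:ℝ) 1) :
    ‖u₁ t‖ ≤ 4 * expWeight (c * z.re) ‖u₁ 1‖ ‖u₂ 0‖ H t ∧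
    ‖u₂ t‖ ≤ 4 * expWeight (c * z.re) ‖u₁ 1‖ ‖u₂ 0‖ H t ∧
    ‖u₁ t - Complex.exp (-(β₁ * z * (1 - t))) * u₁ 1‖
      ≤ (4 * M + 1) * expWeight (c * z.re) ‖u₁ 1‖ ‖u₂ 0‖ H t / (c * z.re) ∧
    ‖u₂ t - Complex.exp (-(β₂ * z * t)) * u₂ 0‖
      ≤ (4 * M + 1) * expWeight (c * z.re) ‖u₁ 1‖ ‖u₂ 0‖ H t / (c * z.re) := by
  have hcz : 0 < c * z.re := mul_pos hc hz
  set w := expWeight (c * z.re) ‖u₁ 1‖ ‖u₂ 0‖ H with hw_def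
  have hM0 : 0 ≤ M := (norm_nonneg _).trans (hq₁ t ht)
  have hHw : ∀ s, H ≤ w s := fun s => by
    simp only [hw_def, expWeight]
    have : 0 ≤ ‖u₁ 1‖ * Real.exp (-(c * z.re * (1 - s))) +
      ‖u₂ 0‖ * Real.exp (-(c * z.re * s)) := by positivity
    linarith
  have hw0 : ∀ s, 0 < w s := fun s => hH.trans_le (hHw s)
  have hwc : Continuous w := by
    change Continuous fun t => expWeight (c * z.re) ‖u₁ 1‖ ‖u₂ 0‖ H t
    unfold expWeight
    fun_prop
  have hdiff : ∀ N, (∀ s ∈ Icc (0:ℝ) 1, ‖u₁ s‖ ≤ N * w s ∧ ‖u₂ s‖ ≤ N * w s) →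
      ∀ t ∈ Icc (0:ℝ) 1,
      ‖u₁ t - Complex.exp (-(β₁ * z * (1 - t))) * u₁ 1‖ ≤ (M * N + 1) * w t / (c * z.re) ∧
      ‖u₂ t - Complex.exp (-(β₂ * z * t)) * u₂ 0‖ ≤ (M * N + 1) * w t / (c * z.re) := by
    intro N hN t ht
    have hN0 : 0 ≤ N := by
      by_contra hneg
      have := (norm_nonneg _).trans (hN t ht).1
      nlinarith [hw0 t]
    have hsrc : ∀ {q e a : ℂ} {s r : ℝ}, ‖q‖ ≤ M → ‖a‖ ≤ N * w s → ‖e‖ ≤ H →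
        s - t ≤ r → t - s ≤ r → 0 ≤ r →
        ‖q * a + e‖ ≤ (M * N + 1) * w t * Real.exp (c * z.re * r) := by
      intro q e a s r hq ha he h1 h2 hr
      calc ‖q * a + e‖ ≤ ‖q‖ * ‖a‖ + ‖e‖ := (norm_add_le _ _).trans (by rw [norm_mul])
        _ ≤ M * (N * w s) + w s := by gcongr; exact he.trans (hHw s)
        _ = (M * N + 1) * w s := by ring
        _ ≤ (M * N + 1) * (w t * Real.exp (c * z.re * r)) := by
          gcongr
          exact expWeight_le hcz.le (norm_nonneg _) (norm_nonneg _) hH.le h1 h2 hr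
        _ = _ := by ring
    constructor
    · refine norm_sub_exp_mul_le_of_hasDerivWithinAt hc hβ₁ hz ht fun s hs => ?_
      have hs' : s ∈ Icc (0:ℝ) 1 := ⟨ht.1.trans hs.1, hs.2⟩
      obtain ⟨e, he, hd⟩ := h.fst s hs'
      exact ⟨_, hsrc (hq₁ s hs') (hN s hs').2 he (by linarith) (by linarith [hs.1])
        (by linarith [hs.1]), hd⟩
    · refine norm_sub_exp_mul_le_of_hasDerivWithinAt' hc hβ₂ hz ht fun s hs => ?_
      have hs' : s ∈ Icc (0:ℝ) 1 := ⟨hs.1, hs.2.trans ht.2⟩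
      obtain ⟨e, he, hd⟩ := h.snd s hs'
      exact ⟨_, hsrc (hq₂ s hs') (hN s hs').1 he (by linarith [hs.2]) (by linarith [hs.2])
        (by linarith [hs.2]), hd⟩
  have hexp : ∀ {β τ : ℝ}, 2 * c ≤ β → 0 ≤ τ → ‖Complex.exp (-(β * z * τ))‖
      ≤ Real.exp (-(c * z.re * τ)) := fun {β τ} hβ hτ => by
    rw [Complex.norm_exp, Real.exp_le_exp]
    simp
    gcongr
    linarith
  have hmain : ∀ N, (∀ s ∈ Icc (0:ℝ) 1, ‖u₁ s‖ ≤ N * w s ∧ ‖u₂ s‖ ≤ N * w s) →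
      ∀ t ∈ Icc (0:ℝ) 1,
      ‖u₁ t‖ ≤ (1 + (M * N + 1) / (c * z.re)) * w t ∧
      ‖u₂ t‖ ≤ (1 + (M * N + 1) / (c * z.re)) * w t := by
    intro N hN t ht
    obtain ⟨h1, h2⟩ := hdiff N hN t ht
    constructor
    · have h3 : ‖Complex.exp (-(β₁ * z * (1 - t))) * u₁ 1‖ ≤ w t := by
        rw [norm_mul]
        have := mul_le_mul_of_nonneg_right (hexp hβ₁ (by linarith [ht.2] : 0 ≤ 1 - t))
          (norm_nonneg (u₁ 1))
        push_cast at this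
        refine this.trans ?_
        simp only [hw_def, expWeight]
        have : 0 ≤ ‖u₂ 0‖ * Real.exp (-(c * z.re * t)) := by positivity
        linarith
      have := norm_le_norm_add_norm_sub' (u₁ t) (Complex.exp (-(β₁ * z * (1 - t))) * u₁ 1)
      rw [add_mul, one_mul, div_mul_eq_mul_div]
      linarith
    · have h3 : ‖Complex.exp (-(β₂ * z * t)) * u₂ 0‖ ≤ w t := by
        rw [norm_mul]
        have := mul_le_mul_of_nonneg_right (hexp hβ₂ ht.1) (norm_nonneg (u₂ 0))
        refine this.trans ?_
        simp only [hw_def, expWeight]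
        have : 0 ≤ ‖u₁ 1‖ * Real.exp (-(c * z.re * (1 - t))) := by positivity
        linarith
      have := norm_le_norm_add_norm_sub' (u₂ t) (Complex.exp (-(β₂ * z * t)) * u₂ 0)
      rw [add_mul, one_mul, div_mul_eq_mul_div]
      linarith
  have hcont₁ : ContinuousOn u₁ (Icc 0 1) := fun x hx => by
    obtain ⟨e, -, hd⟩ := h.fst x hx
    exact hd.continuousWithinAt
  have hcont₂ : ContinuousOn u₂ (Icc 0 1) := fun x hx => by
    obtain ⟨e, -, hd⟩ := h.snd x hx
    exact hd.continuousWithinAt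
  obtain ⟨x₀, hx₀, hmax⟩ := isCompact_Icc.exists_isMaxOn (⟨t, ht⟩ : (Icc (0:ℝ) 1).Nonempty)
    (f := fun x => max ‖u₁ x‖ ‖u₂ x‖ / w x)
    ((hcont₁.norm.sup hcont₂.norm).div hwc.continuousOn fun x _ => (hw0 x).ne')
  set N := max ‖u₁ x₀‖ ‖u₂ x₀‖ / w x₀ with hN_def
  have hN : ∀ s ∈ Icc (0:ℝ) 1, ‖u₁ s‖ ≤ N * w s ∧ ‖u₂ s‖ ≤ N * w s := fun s hs => by
    have h1 : max ‖u₁ s‖ ‖u₂ s‖ / w s ≤ N := hmax hs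
    rw [div_le_iff₀ (hw0 s)] at h1
    exact ⟨(le_max_left _ _).trans h1, (le_max_right _ _).trans h1⟩
  have hN0 : 0 ≤ N := div_nonneg ((norm_nonneg _).trans (le_max_left _ _)) (hw0 _).le
  have hN4 : N ≤ 4 := by
    have h1 : N ≤ 1 + (M * N + 1) / (c * z.re) := by
      conv_lhs => rw [hN_def]
      rw [div_le_iff₀ (hw0 x₀)]
      exact max_le (hmain N hN x₀ hx₀).1 (hmain N hN x₀ hx₀).2
    have h2 : (M * N + 1) / (c * z.re) ≤ N / 2 + 1 := by
      rw [div_le_iff₀ hcz]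
      nlinarith
    linarith
  have hN' : ∀ s ∈ Icc (0:ℝ) 1, ‖u₁ s‖ ≤ 4 * w s ∧ ‖u₂ s‖ ≤ 4 * w s := fun s hs => by
    have := mul_le_mul_of_nonneg_right hN4 (hw0 s).le
    exact ⟨(hN s hs).1.trans this, (hN s hs).2.trans this⟩
  have h5 := hdiff 4 hN' t ht
  rw [mul_comm M 4] at h5
  exact ⟨(hN' t ht).1, (hN' t ht).2, h5.1, h5.2⟩

end

section

lemma exists_hasDerivAt_mul_sub_pow (k : ℕ) {ζ : ℂ} (hζ : 1 ≤ ‖ζ‖) :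
    ∃ P : ℝ → ℂ, (∀ τ : ℝ, HasDerivAt P (ζ * P τ - (τ : ℂ) ^ k) τ) ∧
      P 0 = k.factorial / ζ ^ (k + 1) ∧ ‖P 1‖ ≤ (k + 1).factorial := by
  have hζ0 : ζ ≠ 0 := norm_pos_iff.1 (by linarith)
  have hinv : ‖ζ⁻¹‖ ≤ 1 := by rw [norm_inv]; exact inv_le_one_of_one_le₀ hζ
  induction k with
  | zero =>
    refine ⟨fun _ => ζ⁻¹, fun τ => ?_, by simp, by simpa using hinv⟩
    simpa [hζ0] using hasDerivAt_const τ ζ⁻¹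
  | succ k ih =>
    obtain ⟨P, h1, h2, h3⟩ := ih
    refine ⟨fun τ => ζ⁻¹ * ((τ : ℂ) ^ (k + 1) + (k + 1) * P τ), fun τ => ?_, ?_, ?_⟩
    · have h4 : HasDerivAt (fun τ : ℝ => (τ : ℂ) ^ (k + 1)) ((k + 1) * (τ : ℂ) ^ k) τ := by
        have := (Complex.ofRealCLM.hasDerivAt (x := τ)).fun_pow (k + 1)
        simpa using this
      refine ((h4.add ((h1 τ).const_mul ((k:ℂ) + 1))).const_mul ζ⁻¹).congr_deriv ?_
      field_simp
      ring
    · simp only [Complex.ofReal_zero, h2, Nat.factorial_succ]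
      push_cast
      field_simp
      simp
      ring
    · have h5 : ‖((1:ℝ) : ℂ) ^ (k + 1) + ((k:ℂ) + 1) * P 1‖ ≤ 1 + (k + 1) * (k + 1).factorial := by
        refine (norm_add_le _ _).trans ?_
        have h6 : ‖(k:ℂ) + 1‖ = k + 1 := by
          rw [← Nat.cast_add_one, Complex.norm_natCast]
          push_cast
          ring
        rw [norm_mul, h6]
        simp only [Complex.ofReal_one, one_pow, norm_one]
        gcongr
      rw [norm_mul]
      have h7 : (1:ℝ) ≤ (k + 1).factorial := by exact_mod_cast Nat.one_le_iff_ne_zero.2 (Nat.factorial_ne_zero _)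
      have h8 : ((k + 1 + 1).factorial : ℝ) = (k + 2) * (k + 1).factorial := by
        rw [Nat.factorial_succ (k + 1)]
        push_cast
        ring
      calc _ ≤ 1 * (1 + (k + 1) * ((k + 1).factorial : ℝ)) := by gcongr
        _ ≤ _ := by rw [h8]; linarith

lemma pow_le_factorial_div_mul_exp {x τ : ℝ} (hx : 0 < x) (hτ : 0 ≤ τ) (k : ℕ) :
    τ ^ k ≤ k.factorial / x ^ k * Real.exp (x * τ) := by
  have h := Real.pow_div_factorial_le_exp (x * τ) (by positivity) k
  rw [div_le_iff₀ (by positivity), mul_pow] at h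
  rw [div_mul_eq_mul_div, le_div_iff₀ (by positivity)]
  linarith

variable {β₁ β₂ c M : ℝ} {q₁ q₂ : ℝ → ℂ}

lemma ApproxSolution.endpoint_estimate {z : ℂ} {H : ℝ} {u₁ u₂ : ℝ → ℂ}
    (h : ApproxSolution β₁ β₂ q₁ q₂ z H u₁ u₂) (hc : 0 < c) (hβ₁ : 2 * c ≤ β₁) (hβ₂ : 2 * c ≤ β₂)
    (hq₁ : ∀ x ∈ Icc (0:ℝ) 1, ‖q₁ x‖ ≤ M) (hq₂ : ∀ x ∈ Icc (0:ℝ) 1, ‖q₂ x‖ ≤ M)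
    {g : ℂ} {L : ℝ} {k : ℕ} (hL : 0 ≤ L)
    (hg : ∀ x ∈ Icc (0:ℝ) 1, ‖q₂ x - g * ((1 - x : ℝ) : ℂ) ^ k‖ ≤ L * (1 - x) ^ (k + 1))
    (hH : 0 < H) (hM : 2 * M + 1 ≤ c * z.re) (hz1 : 1 ≤ (β₁ + β₂) * z.re) :
    ‖u₁ 1‖ * (‖g‖ * k.factorial / ((β₁ + β₂) * ‖z‖) ^ (k + 1)) ≤ ‖u₂ 1‖ +
      Real.exp (-(c * z.re)) * (‖u₂ 0‖ + ‖u₁ 1‖ * (‖g‖ * (k + 1).factorial)) +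
      (‖u₁ 1‖ * (((‖g‖ + L) * (4 * M + 1) * k.factorial + L * (k + 1).factorial)
        / (c * z.re) ^ (k + 1)) + ((‖g‖ + L) * (4 * M + 1) + 1) *
          (‖u₂ 0‖ * Real.exp (-(c * z.re)) + H)) / (c * z.re) := by
  have hM0 : 0 ≤ M := (norm_nonneg _).trans (hq₁ 0 ⟨le_rfl, zero_le_one⟩)
  set x := c * z.re with hx_def
  have hx1 : 1 ≤ x := by linarith
  have hx : 0 < x := by linarith
  have hz : 0 < z.re := pos_of_mul_pos_right hx hc.le
  have hγ : 0 < β₁ + β₂ := by linarith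
  have hζ : 1 ≤ ‖((β₁ + β₂ : ℝ) : ℂ) * z‖ := by
    refine hz1.trans ?_
    rw [norm_mul, Complex.norm_real, Real.norm_eq_abs, abs_of_pos hγ]
    gcongr
    exact Complex.re_le_norm z
  obtain ⟨P, hP, hP0, hP1⟩ := exists_hasDerivAt_mul_sub_pow k hζ
  set A := u₁ 1 with hA
  set B := u₂ 0 with hB
  set K := ‖g‖ + L with hK
  have hK0 : 0 ≤ K := by positivity
  set e : ℝ → ℂ := fun t => Complex.exp (-(β₁ * z * (1 - t))) with he
  have hexp : ∀ {β τ : ℝ}, 2 * c ≤ β → 0 ≤ τ → ‖Complex.exp (-(β * z * τ))‖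
      ≤ Real.exp (-(x * τ)) := fun {β τ} hβ hτ => by
    rw [Complex.norm_exp, Real.exp_le_exp]
    simp [hx_def]
    gcongr
    linarith
  set v : ℝ → ℂ := fun t => u₂ t - A * g * (e t * P (1 - t)) with hv_def
  have hψ : ∀ t : ℝ, HasDerivAt (fun t : ℝ => e t * P (1 - t))
      (-(β₂ * z * (e t * P (1 - t))) + e t * ((1 - t : ℝ) : ℂ) ^ k) t := fun t => by
    have h1 : HasDerivAt (fun s : ℝ => -(β₁ * z * (1 - (s:ℂ)))) (-(β₁ * z * -1)) t :=
      (((Complex.ofRealCLM.hasDerivAt (x := t)).const_sub 1).const_mul (β₁ * z)).neg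
    have h2 : HasDerivAt (fun s : ℝ => P (1 - s))
        (-((((β₁ + β₂ : ℝ) : ℂ) * z) * P (1 - t) - ((1 - t : ℝ) : ℂ) ^ k)) t := by
      have := (hP (1 - t)).scomp t ((hasDerivAt_id t).const_sub 1)
      simpa [Function.comp_def] using this
    refine (h1.cexp.mul h2).congr_deriv ?_
    simp only [he]
    push_cast
    ring
  set D := ‖A‖ * ((K * (4 * M + 1) * k.factorial + L * (k + 1).factorial) / x ^ (k + 1)) +
    (K * (4 * M + 1) + 1) * (‖B‖ * Real.exp (-x) + H) with hD
  have key := norm_sub_exp_mul_le_of_hasDerivWithinAt' (β := β₂) (z := z) (v := v) (t := 1)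
    (D := D) hc hβ₂ hz ⟨zero_le_one, le_rfl⟩ (fun s hs => by
      obtain ⟨h', hh', hd⟩ := h.snd s hs
      set τ := 1 - s with hτ_def
      have hτ0 : 0 ≤ τ := by linarith [hs.2]
      have hτ1 : τ ≤ 1 := by linarith [hs.1]
      refine ⟨q₂ s * (u₁ s - e s * A) + A * e s * (q₂ s - g * (τ : ℂ) ^ k) + h', ?_, ?_⟩
      · have hr : ‖u₁ s - e s * A‖ ≤ (4 * M + 1) * expWeight x ‖A‖ ‖B‖ H s / x :=
          (h.bounds hc hβ₁ hβ₂ hq₁ hq₂ hH hz hM hs).2.2.1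
        have hes : ‖e s‖ ≤ Real.exp (-(x * τ)) := by
          have := hexp (β := β₁) (τ := τ) hβ₁ hτ0
          simpa [he, hτ_def] using this
        have hqs : ‖q₂ s‖ ≤ K * τ ^ k := by
          have h1 := norm_le_norm_add_norm_sub' (q₂ s) (g * (τ : ℂ) ^ k)
          have h2 := hg s hs
          rw [norm_mul, norm_pow, Complex.norm_real, Real.norm_eq_abs, abs_of_nonneg hτ0] at h1
          have h3 : τ ^ (k + 1) ≤ τ ^ k := pow_le_pow_of_le_one hτ0 hτ1 (Nat.le_succ k)
          have h4 := mul_le_mul_of_nonneg_left h3 hL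
          rw [hK, add_mul]
          linarith
        have hE1 : 1 ≤ Real.exp (x * τ) := Real.one_le_exp (by positivity)
        have hEE : Real.exp (-(x * τ)) * Real.exp (x * τ) = 1 := by
          rw [← Real.exp_add]; simp
        have hw : τ ^ k * expWeight x ‖A‖ ‖B‖ H s ≤
            (‖A‖ * (k.factorial / x ^ k) + (‖B‖ * Real.exp (-x) + H)) * Real.exp (x * τ) := by
          unfold expWeight
          have hB' : Real.exp (-(x * s)) = Real.exp (-x) * Real.exp (x * τ) := by
            rw [← Real.exp_add]; congr 1; rw [hτ_def]; ring
          have h1 : τ ^ k * (‖A‖ * Real.exp (-(x * τ))) ≤ ‖A‖ * (k.factorial / x ^ k) := by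
            calc τ ^ k * (‖A‖ * Real.exp (-(x * τ)))
                ≤ (k.factorial / x ^ k * Real.exp (x * τ)) * (‖A‖ * Real.exp (-(x * τ))) := by
                  gcongr; exact pow_le_factorial_div_mul_exp hx hτ0 k
              _ = ‖A‖ * (k.factorial / x ^ k) * (Real.exp (-(x * τ)) * Real.exp (x * τ)) := by ring
              _ = _ := by rw [hEE, mul_one]
          have h2 : ‖A‖ * (k.factorial / x ^ k) ≤
              ‖A‖ * (k.factorial / x ^ k) * Real.exp (x * τ) :=
            le_mul_of_one_le_right (by positivity) hE1
          have h3 : τ ^ k ≤ 1 := pow_le_one₀ hτ0 hτ1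
          have h4 : τ ^ k * (‖B‖ * Real.exp (-(x * s)) + H)
              ≤ ‖B‖ * Real.exp (-x) * Real.exp (x * τ) + H * Real.exp (x * τ) := by
            refine (mul_le_of_le_one_left (by positivity) h3).trans ?_
            have h5 := le_mul_of_one_le_right hH.le hE1
            rw [hB', ← mul_assoc]
            linarith
          nlinarith
        have hL' : ‖A‖ * ‖e s‖ * (L * τ ^ (k + 1)) ≤
            ‖A‖ * L * ((k + 1).factorial / x ^ (k + 1)) * Real.exp (x * τ) := by
          calc ‖A‖ * ‖e s‖ * (L * τ ^ (k + 1)) ≤ ‖A‖ * 1 * (L * ((k + 1).factorial / x ^ (k + 1)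
                * Real.exp (x * τ))) := by
                gcongr
                · exact hes.trans (Real.exp_le_one_iff.2 (by nlinarith))
                · exact pow_le_factorial_div_mul_exp hx hτ0 (k + 1)
            _ = _ := by ring
        have hs1 : ‖q₂ s * (u₁ s - e s * A)‖ ≤
            (K * (4 * M + 1) / x * (‖A‖ * (k.factorial / x ^ k) + (‖B‖ * Real.exp (-x) + H)))
              * Real.exp (x * τ) := by
          rw [norm_mul]
          calc ‖q₂ s‖ * ‖u₁ s - e s * A‖
              ≤ (K * τ ^ k) * ((4 * M + 1) * expWeight x ‖A‖ ‖B‖ H s / x) := by gcongr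
            _ = K * (4 * M + 1) / x * (τ ^ k * expWeight x ‖A‖ ‖B‖ H s) := by ring
            _ ≤ K * (4 * M + 1) / x * ((‖A‖ * (k.factorial / x ^ k) +
                  (‖B‖ * Real.exp (-x) + H)) * Real.exp (x * τ)) := by gcongr
            _ = _ := by ring
        have hs2 : ‖A * e s * (q₂ s - g * (τ : ℂ) ^ k)‖ ≤
            ‖A‖ * L * ((k + 1).factorial / x ^ (k + 1)) * Real.exp (x * τ) := by
          rw [norm_mul, norm_mul]
          refine le_trans ?_ hL'
          gcongr
          exact hg s hs
        refine (norm_add₃_le).trans ?_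
        have hs3 : ‖h'‖ ≤ H * Real.exp (x * τ) := hh'.trans (le_mul_of_one_le_right hH.le hE1)
        refine (add_le_add_three hs1 hs2 hs3).trans ?_
        rw [← add_mul, ← add_mul]
        refine mul_le_mul_of_nonneg_right ?_ (by positivity)
        have h6 : K * (4 * M + 1) / x * (‖B‖ * Real.exp (-x) + H)
            ≤ K * (4 * M + 1) * (‖B‖ * Real.exp (-x) + H) := by
          gcongr
          exact div_le_self (by positivity) hx1
        have h7 : 0 ≤ ‖B‖ * Real.exp (-x) := by positivity
        have h8 : K * (4 * M + 1) / x * (‖A‖ * (k.factorial / x ^ k)) +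
            ‖A‖ * L * ((k + 1).factorial / x ^ (k + 1)) =
            ‖A‖ * ((K * (4 * M + 1) * k.factorial + L * (k + 1).factorial) / x ^ (k + 1)) := by
          field_simp
          ring
        rw [hD, ← h8]
        linarith
      · refine (hd.sub ((hψ s).hasDerivWithinAt.const_mul (A * g))).congr_deriv ?_
        simp only [hv_def]
        ring)
  have hv1 : v 1 = u₂ 1 - A * g * (k.factorial / (((β₁ + β₂ : ℝ) : ℂ) * z) ^ (k + 1)) := by
    simp [hv_def, he, hP0]
  have hv0 : v 0 = B - A * g * (e 0 * P 1) := by simp [hv_def, hB]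
  have hv0n : ‖v 0‖ ≤ ‖B‖ + ‖A‖ * (‖g‖ * (k + 1).factorial) := by
    rw [hv0]
    refine (norm_sub_le _ _).trans ?_
    rw [norm_mul, norm_mul, norm_mul, mul_assoc]
    have he0 : ‖e 0‖ ≤ 1 := by
      have := hexp (β := β₁) (τ := 1) hβ₁ zero_le_one
      refine le_trans ?_ (this.trans (Real.exp_le_one_iff.2 (by linarith)))
      simp [he]
    gcongr
    calc ‖e 0‖ * ‖P 1‖ ≤ 1 * (k + 1).factorial := by gcongr
      _ = _ := one_mul _
  have he1 : ‖Complex.exp (-(β₂ * z * (1 : ℝ))) * v 0‖ ≤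
      Real.exp (-x) * (‖B‖ + ‖A‖ * (‖g‖ * (k + 1).factorial)) := by
    rw [norm_mul]
    have := hexp (β := β₂) (τ := 1) hβ₂ zero_le_one
    rw [mul_one] at this
    gcongr
  have hn : ‖A * g * (k.factorial / (((β₁ + β₂ : ℝ) : ℂ) * z) ^ (k + 1))‖ =
      ‖A‖ * (‖g‖ * k.factorial / ((β₁ + β₂) * ‖z‖) ^ (k + 1)) := by
    rw [norm_mul, norm_mul, norm_div, norm_pow, norm_mul, Complex.norm_real, Real.norm_eq_abs,
      abs_of_pos hγ, Complex.norm_natCast]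
    ring
  rw [← hn]
  have htri : ‖A * g * (k.factorial / (((β₁ + β₂ : ℝ) : ℂ) * z) ^ (k + 1))‖ ≤
      ‖u₂ 1‖ + ‖v 1‖ := by
    rw [hv1]
    have := norm_le_norm_add_norm_sub (u₂ 1)
      (A * g * (k.factorial / (((β₁ + β₂ : ℝ) : ℂ) * z) ^ (k + 1)))
    linarith
  have htri2 := norm_le_norm_add_norm_sub' (v 1) (Complex.exp (-(β₂ * z * (1 : ℝ))) * v 0)
  linarith

end

section

lemma eventually_mul_pow_mul_exp_neg_le {c : ℝ} (hc : 0 < c) (n : ℕ) (K : ℝ) {ε : ℝ} (hε : 0 < ε) :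
    ∀ᶠ σ : ℝ in atTop, K * (σ ^ n * Real.exp (-(c * σ))) ≤ ε := by
  have h1 : Tendsto (fun σ : ℝ => c * σ) atTop atTop := tendsto_id.const_mul_atTop hc
  have h2 := ((Real.tendsto_pow_mul_exp_neg_atTop_nhds_zero n).comp h1).const_mul (K / c ^ n)
  rw [mul_zero] at h2
  filter_upwards [h2.eventually_le_const hε] with σ hσ
  refine le_of_eq_of_le ?_ hσ
  simp only [Function.comp_apply, mul_pow]
  field_simp

lemma eventually_div_le (K : ℝ) {ε : ℝ} (hε : 0 < ε) : ∀ᶠ σ : ℝ in atTop, K / σ ≤ ε :=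
  (tendsto_const_nhds.div_atTop tendsto_id).eventually_le_const hε

variable {β₁ β₂ c M : ℝ} {q₁ q₂ : ℝ → ℂ}

lemma exists_eventually_norm_fst_one_le (hc : 0 < c) (hβ₁ : 2 * c ≤ β₁) (hβ₂ : 2 * c ≤ β₂)
    (hq₁ : ∀ x ∈ Icc (0:ℝ) 1, ‖q₁ x‖ ≤ M) (hq₂ : ∀ x ∈ Icc (0:ℝ) 1, ‖q₂ x‖ ≤ M)
    {g : ℂ} {L : ℝ} {k : ℕ} (hg0 : g ≠ 0) (hL : 0 ≤ L)
    (hg : ∀ x ∈ Icc (0:ℝ) 1, ‖q₂ x - g * ((1 - x : ℝ) : ℂ) ^ k‖ ≤ L * (1 - x) ^ (k + 1)) :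
    ∃ C, 0 < C ∧ ∀ᶠ σ : ℝ in atTop, ∀ (z : ℂ) (H : ℝ) (u₁ u₂ : ℝ → ℂ), z.re = σ → ‖z‖ ≤ 2 * σ →
      0 < H → ApproxSolution β₁ β₂ q₁ q₂ z H u₁ u₂ →
      ‖u₁ 1‖ ≤ C * σ ^ (k + 1) * (‖u₂ 1‖ + ‖u₂ 0‖ * Real.exp (-(c * σ)) + H) := by
  have hM0 : 0 ≤ M := (norm_nonneg _).trans (hq₁ 0 ⟨le_rfl, zero_le_one⟩)
  have hγ : 0 < β₁ + β₂ := by linarith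
  have hgn : 0 < ‖g‖ := norm_pos_iff.2 hg0
  set c₀ := ‖g‖ * k.factorial / (2 * (β₁ + β₂)) ^ (k + 1) with hc₀
  have hc₀' : 0 < c₀ := by positivity
  set G := ‖g‖ * (k + 1).factorial
  set C₁ := (‖g‖ + L) * (4 * M + 1) * k.factorial + L * (k + 1).factorial
  set C₂ := (‖g‖ + L) * (4 * M + 1) + 1
  have hC₂ : 0 ≤ C₂ := by positivity
  refine ⟨2 * (1 + C₂) / c₀, by positivity, ?_⟩
  filter_upwards [eventually_mul_pow_mul_exp_neg_le hc (k + 1) G (by positivity : 0 < c₀ / 4),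
    eventually_div_le (C₁ / c ^ (k + 2)) (by positivity : 0 < c₀ / 4),
    eventually_ge_atTop ((2 * M + 1) / c), eventually_ge_atTop (1 / (β₁ + β₂)),
    eventually_gt_atTop 0] with σ h1 h2 h3 h4 hσ z H u₁ u₂ hz hz2 hH h
  rw [div_le_iff₀ hc] at h3
  rw [div_le_iff₀ hγ] at h4
  have hx1 : 1 ≤ c * σ := by linarith
  have key := h.endpoint_estimate hc hβ₁ hβ₂ hq₁ hq₂ hL hg hH (by rw [hz]; linarith)
    (by rw [hz]; linarith)
  rw [hz] at key
  set A := ‖u₁ 1‖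
  set B := ‖u₂ 0‖
  set ε := Real.exp (-(c * σ))
  set S := σ ^ (k + 1)
  have hS : 0 < S := by positivity
  have hz0 : 0 < ‖z‖ := lt_of_lt_of_le (by linarith) (Complex.re_le_norm z)
  have hlow : A * c₀ ≤ S * (A * (‖g‖ * k.factorial / ((β₁ + β₂) * ‖z‖) ^ (k + 1))) := by
    have : c₀ / S ≤ ‖g‖ * k.factorial / ((β₁ + β₂) * ‖z‖) ^ (k + 1) := by
      rw [hc₀, div_div, ← mul_pow]
      exact div_le_div_of_nonneg_left (by positivity) (by positivity) (pow_le_pow_left₀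
        (by positivity) (by linarith [mul_le_mul_of_nonneg_left hz2 hγ.le]) _)
    calc A * c₀ = S * (A * (c₀ / S)) := by field_simp
      _ ≤ _ := by gcongr
  have hup := hlow.trans (mul_le_mul_of_nonneg_left key hS.le)
  have hW : 0 ≤ B * ε + H := by positivity
  have h5 : (A * (C₁ / (c * σ) ^ (k + 1)) + C₂ * (B * ε + H)) / (c * σ)
      ≤ A * (C₁ / c ^ (k + 2) / σ) / S + C₂ * (B * ε + H) := by
    rw [add_div]
    refine add_le_add (le_of_eq ?_) (div_le_self (by positivity) hx1)
    simp only [S]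
    field_simp
    ring
  have h6 : S * (A * (C₁ / c ^ (k + 2) / σ) / S) = A * (C₁ / c ^ (k + 2) / σ) := by
    field_simp
  have hA : 0 ≤ A := norm_nonneg _
  have h7 := mul_le_mul_of_nonneg_left h2 hA
  have h8 := mul_le_mul_of_nonneg_left h1 hA
  have h9 := mul_le_mul_of_nonneg_left h5 hS.le
  have h10 : A * c₀ / 2 ≤ S * ((1 + C₂) * (‖u₂ 1‖ + B * ε + H)) := by
    have h11 : 0 ≤ S * (C₂ * ‖u₂ 1‖) := by positivity
    have h12 : 0 ≤ S * H := by positivity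
    nlinarith
  have h13 : A = (A * c₀ / 2) * (2 / c₀) := by field_simp
  rw [h13]
  calc _ ≤ S * ((1 + C₂) * (‖u₂ 1‖ + B * ε + H)) * (2 / c₀) := by gcongr
    _ = _ := by ring

lemma expWeight_le_add {κ A B H t : ℝ} (hκ : 0 ≤ κ) (hA : 0 ≤ A) (hB : 0 ≤ B)
    (ht : t ∈ Icc (0:ℝ) 1) : expWeight κ A B H t ≤ A + B + H := by
  unfold expWeight
  gcongr
  · refine mul_le_of_le_one_right hA (Real.exp_le_one_iff.2 ?_)
    have : 0 ≤ κ * (1 - t) := mul_nonneg hκ (by linarith [ht.2])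
    linarith
  · refine mul_le_of_le_one_right hB (Real.exp_le_one_iff.2 ?_)
    have : 0 ≤ κ * t := mul_nonneg hκ ht.1
    linarith

lemma ApproxSolution.norm_fst_zero_le {z : ℂ} {H : ℝ} {u₁ u₂ : ℝ → ℂ}
    (h : ApproxSolution β₁ β₂ q₁ q₂ z H u₁ u₂) (hc : 0 < c) (hβ₁ : 2 * c ≤ β₁) (hβ₂ : 2 * c ≤ β₂)
    (hq₁ : ∀ x ∈ Icc (0:ℝ) 1, ‖q₁ x‖ ≤ M) (hq₂ : ∀ x ∈ Icc (0:ℝ) 1, ‖q₂ x‖ ≤ M)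
    (hH : 0 < H) (hz : 0 < z.re) (hM : 2 * M + 1 ≤ c * z.re) :
    ‖u₁ 0‖ ≤ Real.exp (-(c * z.re)) * ‖u₁ 1‖ + (4 * M + 1) *
      (Real.exp (-(c * z.re)) * ‖u₁ 1‖ + ‖u₂ 0‖ + H) / (c * z.re) := by
  have h0 : (0:ℝ) ∈ Icc (0:ℝ) 1 := ⟨le_rfl, zero_le_one⟩
  have h1 := (h.bounds hc hβ₁ hβ₂ hq₁ hq₂ hH hz hM h0).2.2.1
  have h2 := norm_le_norm_add_norm_sub' (u₁ 0)
    (Complex.exp (-(β₁ * z * (1 - (0:ℝ)))) * u₁ 1)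
  have h3 : ‖Complex.exp (-(β₁ * z * (1 - (0:ℝ))))‖ ≤ Real.exp (-(c * z.re)) := by
    rw [Complex.norm_exp, Real.exp_le_exp]
    simp
    gcongr
    linarith
  rw [norm_mul] at h2
  have h4 := mul_le_mul_of_nonneg_right h3 (norm_nonneg (u₁ 1))
  have h5 : expWeight (c * z.re) ‖u₁ 1‖ ‖u₂ 0‖ H 0 =
      Real.exp (-(c * z.re)) * ‖u₁ 1‖ + ‖u₂ 0‖ + H := by
    simp [expWeight, mul_comm]
  rw [h5] at h1
  linarith

lemma exists_eventually_norm_le_of_snd_one_eq_zero (hc : 0 < c) (hβ₁ : 2 * c ≤ β₁)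
    (hβ₂ : 2 * c ≤ β₂)
    (hq₁ : ∀ x ∈ Icc (0:ℝ) 1, ‖q₁ x‖ ≤ M) (hq₂ : ∀ x ∈ Icc (0:ℝ) 1, ‖q₂ x‖ ≤ M)
    {g : ℂ} {L : ℝ} {k : ℕ} (hg0 : g ≠ 0) (hL : 0 ≤ L)
    (hg : ∀ x ∈ Icc (0:ℝ) 1, ‖q₂ x - g * ((1 - x : ℝ) : ℂ) ^ k‖ ≤ L * (1 - x) ^ (k + 1))
    {α₁ α₂ α₃ : ℂ} (hα₂ : α₂ ≠ 0) :
    ∃ C, 0 < C ∧ ∀ᶠ σ : ℝ in atTop, ∀ (z : ℂ) (H : ℝ) (u₁ u₂ : ℝ → ℂ), z.re = σ → ‖z‖ ≤ 2 * σ →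
      0 < H → ApproxSolution β₁ β₂ q₁ q₂ z H u₁ u₂ → u₂ 1 = 0 →
      α₁ * u₁ 0 + α₂ * u₂ 0 + α₃ * u₁ 1 = 0 →
      ∀ t ∈ Icc (0:ℝ) 1, ‖u₁ t‖ ≤ C * σ ^ (k + 1) * H ∧ ‖u₂ t‖ ≤ C * σ ^ (k + 1) * H := by
  have hM0 : 0 ≤ M := (norm_nonneg _).trans (hq₁ 0 ⟨le_rfl, zero_le_one⟩)
  have ha₂ : 0 < ‖α₂‖ := norm_pos_iff.2 hα₂
  obtain ⟨C, hC, hev⟩ := exists_eventually_norm_fst_one_le hc hβ₁ hβ₂ hq₁ hq₂ hg0 hL hg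
  set a := (4 * ‖α₁‖ + 2 * ‖α₃‖) / ‖α₂‖ with ha
  have ha0 : 0 ≤ a := by positivity
  refine ⟨16 * (1 + a) * C + 8, by positivity, ?_⟩
  filter_upwards [hev, eventually_mul_pow_mul_exp_neg_le hc (k + 1) (C * a) one_half_pos,
    eventually_ge_atTop ((4 * M + 1) / c),
    eventually_div_le (‖α₁‖ * (4 * M + 1) / c) (half_pos ha₂),
    eventually_ge_atTop 1] with σ hσ h1 h3 h4 hσ1 z H u₁ u₂ hz hz2 hH h hu1 hbc t ht
  rw [div_le_iff₀ hc] at h3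
  have hx : 0 < c * σ := by positivity
  have hA := hσ z H u₁ u₂ hz hz2 hH h
  have hM : 2 * M + 1 ≤ c * z.re := by rw [hz]; linarith
  have hzp : 0 < z.re := by linarith
  have h0 := h.norm_fst_zero_le hc hβ₁ hβ₂ hq₁ hq₂ hH hzp hM
  have hb := h.bounds hc hβ₁ hβ₂ hq₁ hq₂ hH hzp hM ht
  rw [hz] at h0 hb
  rw [hu1, norm_zero, zero_add] at hA
  have hw := expWeight_le_add (H := H) hx.le (norm_nonneg (u₁ 1)) (norm_nonneg (u₂ 0)) ht
  have hε1 : Real.exp (-(c * σ)) ≤ 1 := Real.exp_le_one_iff.2 (by linarith)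
  have hε0 : 0 < Real.exp (-(c * σ)) := Real.exp_pos _
  have hbc' : ‖α₂‖ * ‖u₂ 0‖ ≤ ‖α₁‖ * ‖u₁ 0‖ + ‖α₃‖ * ‖u₁ 1‖ := by
    rw [← norm_mul, ← norm_mul, ← norm_mul,
      show α₂ * u₂ 0 = -(α₁ * u₁ 0 + α₃ * u₁ 1) by linear_combination hbc, norm_neg]
    exact norm_add_le _ _
  set A := ‖u₁ 1‖
  set B := ‖u₂ 0‖
  set ε := Real.exp (-(c * σ))
  set S := σ ^ (k + 1)
  have hA0 : 0 ≤ A := norm_nonneg _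
  have hB0 : 0 ≤ B := norm_nonneg _
  have hS1 : 1 ≤ S := one_le_pow₀ hσ1
  have hεA : ε * A ≤ A := mul_le_of_le_one_left hA0 hε1
  have hr : (4 * M + 1) / (c * σ) ≤ 1 := by rw [div_le_one hx]; linarith
  have hr0 : 0 ≤ (4 * M + 1) / (c * σ) := by positivity
  have h5 : ‖α₁‖ * ((4 * M + 1) / (c * σ)) ≤ ‖α₂‖ / 2 := by
    refine le_of_eq_of_le ?_ h4
    field_simp
  have h0' : ‖u₁ 0‖ ≤ 2 * A + (4 * M + 1) / (c * σ) * (B + H) := by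
    refine h0.trans ?_
    rw [mul_div_right_comm, add_assoc (ε * A), mul_add]
    have := mul_le_mul hr hεA (by positivity) zero_le_one
    linarith
  have hB : B ≤ a * A + H := by
    have h6 := mul_le_mul_of_nonneg_left h0' (norm_nonneg α₁)
    have h7 := mul_le_mul_of_nonneg_right h5 (by positivity : 0 ≤ B + H)
    have h8 : a * A = (4 * ‖α₁‖ + 2 * ‖α₃‖) * A / ‖α₂‖ := by rw [ha]; ring
    have h9 : ‖α₂‖ * (a * A) = (4 * ‖α₁‖ + 2 * ‖α₃‖) * A := by rw [h8]; field_simp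
    refine le_of_mul_le_mul_left ?_ ha₂
    rw [mul_add, h9]
    linarith
  have hAf : A ≤ 4 * C * S * H := by
    have h6 : C * S * (B * ε + H) ≤ C * S * ((a * A + H) * ε + H) := by gcongr
    have h7 : C * S * (H * ε) ≤ C * S * H := by
      have : H * ε ≤ H := mul_le_of_le_one_right hH.le hε1
      gcongr
    have h8 := mul_le_mul_of_nonneg_right h1 hA0
    nlinarith
  have hfin : 4 * (A + B + H) ≤ (16 * (1 + a) * C + 8) * S * H := by
    have h6 : (1 + a) * A ≤ (1 + a) * (4 * C * S * H) := by gcongr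
    have h7 : H ≤ S * H := le_mul_of_one_le_left hH.le hS1
    nlinarith
  exact ⟨by linarith [hb.1], by linarith [hb.2.1]⟩

lemma exists_eventually_norm_le_of_snd_zero_eq_zero (hc : 0 < c) (hβ₁ : 2 * c ≤ β₁)
    (hβ₂ : 2 * c ≤ β₂)
    (hq₁ : ∀ x ∈ Icc (0:ℝ) 1, ‖q₁ x‖ ≤ M) (hq₂ : ∀ x ∈ Icc (0:ℝ) 1, ‖q₂ x‖ ≤ M)
    {g : ℂ} {L : ℝ} {k : ℕ} (hg0 : g ≠ 0) (hL : 0 ≤ L)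
    (hg : ∀ x ∈ Icc (0:ℝ) 1, ‖q₂ x - g * ((1 - x : ℝ) : ℂ) ^ k‖ ≤ L * (1 - x) ^ (k + 1))
    {α₁ α₂ α₃ : ℂ} (hα₂ : α₂ ≠ 0) :
    ∃ C, 0 < C ∧ ∀ᶠ σ : ℝ in atTop, ∀ (z : ℂ) (H : ℝ) (u₁ u₂ : ℝ → ℂ), z.re = σ → ‖z‖ ≤ 2 * σ →
      0 < H → ApproxSolution β₁ β₂ q₁ q₂ z H u₁ u₂ → u₂ 0 = 0 →
      α₁ * u₁ 1 + α₂ * u₂ 1 + α₃ * u₁ 0 = 0 →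
      ∀ t ∈ Icc (0:ℝ) 1, ‖u₁ t‖ ≤ C * σ ^ (k + 1) * H ∧ ‖u₂ t‖ ≤ C * σ ^ (k + 1) * H := by
  have hM0 : 0 ≤ M := (norm_nonneg _).trans (hq₁ 0 ⟨le_rfl, zero_le_one⟩)
  have ha₂ : 0 < ‖α₂‖ := norm_pos_iff.2 hα₂
  have hfst : ∃ C, 0 < C ∧ ∀ᶠ σ : ℝ in atTop, ∀ (z : ℂ) (H : ℝ) (u₁ u₂ : ℝ → ℂ), z.re = σ →
      ‖z‖ ≤ 2 * σ → 0 < H → ApproxSolution β₁ β₂ q₁ q₂ z H u₁ u₂ → u₂ 0 = 0 →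
      α₁ * u₁ 1 + α₂ * u₂ 1 + α₃ * u₁ 0 = 0 → ‖u₁ 1‖ ≤ C * σ ^ (k + 1) * H := by
    have hzero : ∀ᶠ σ : ℝ in atTop, ∀ (z : ℂ) (H : ℝ) (u₁ u₂ : ℝ → ℂ), z.re = σ → 0 < H →
        ApproxSolution β₁ β₂ q₁ q₂ z H u₁ u₂ → u₂ 0 = 0 →
        ‖u₁ 0‖ ≤ 2 * (‖u₁ 1‖ * Real.exp (-(c * σ))) + H := by
      filter_upwards [eventually_ge_atTop ((4 * M + 1) / c), eventually_ge_atTop 1]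
        with σ h3 hσ1 z H u₁ u₂ hz hH h hu0
      rw [div_le_iff₀ hc] at h3
      have h0 := h.norm_fst_zero_le hc hβ₁ hβ₂ hq₁ hq₂ hH (by linarith) (by rw [hz]; linarith)
      rw [hz, hu0, norm_zero, add_zero] at h0
      have hx : 0 < c * σ := by positivity
      have hr : (4 * M + 1) / (c * σ) ≤ 1 := by rw [div_le_one hx]; linarith
      rw [mul_div_right_comm] at h0
      have := mul_le_of_le_one_left
        (by positivity : 0 ≤ Real.exp (-(c * σ)) * ‖u₁ 1‖ + H) hr
      linarith
    by_cases hα₁ : α₁ = 0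
    · obtain ⟨C, hC, hev⟩ := exists_eventually_norm_fst_one_le hc hβ₁ hβ₂ hq₁ hq₂ hg0 hL hg
      set b := ‖α₃‖ / ‖α₂‖ with hb
      have hb0 : 0 ≤ b := by positivity
      refine ⟨2 * C * (b + 1), by positivity, ?_⟩
      filter_upwards [hev, hzero,
        eventually_mul_pow_mul_exp_neg_le hc (k + 1) (2 * C * b) one_half_pos,
        eventually_gt_atTop 0] with σ hσ h0 h1 hσ0 z H u₁ u₂ hz hz2 hH h hu0 hbc
      have hA := hσ z H u₁ u₂ hz hz2 hH h
      have h0' := h0 z H u₁ u₂ hz hH h hu0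
      rw [hu0, norm_zero, zero_mul, add_zero] at hA
      have hu21 : ‖u₂ 1‖ = b * ‖u₁ 0‖ := by
        have h2 : α₂ * u₂ 1 = -(α₃ * u₁ 0) := by rw [hα₁] at hbc; linear_combination hbc
        have h3 : ‖α₂‖ * ‖u₂ 1‖ = ‖α₃‖ * ‖u₁ 0‖ := by
          rw [← norm_mul, h2, norm_neg, norm_mul]
        rw [hb, div_mul_eq_mul_div, eq_div_iff ha₂.ne', mul_comm, h3]
      have h4 : C * σ ^ (k + 1) * (‖u₂ 1‖ + H) ≤ C * σ ^ (k + 1) *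
          (b * (2 * (‖u₁ 1‖ * Real.exp (-(c * σ))) + H) + H) := by
        rw [hu21]
        gcongr
      have h5 := mul_le_mul_of_nonneg_right h1 (norm_nonneg (u₁ 1))
      nlinarith
    · have ha₁ : 0 < ‖α₁‖ := norm_pos_iff.2 hα₁
      refine ⟨1 / 2 + 2 * ‖α₃‖ / ‖α₁‖, by positivity, ?_⟩
      filter_upwards [hzero,
        eventually_mul_pow_mul_exp_neg_le hc 0 (2 * ‖α₃‖) (by positivity : 0 < ‖α₁‖ / 4),
        eventually_ge_atTop ((4 * M + 1) / c),
        eventually_div_le (‖α₂‖ * (4 * M + 1) / c) (by positivity : 0 < ‖α₁‖ / 4),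
        eventually_ge_atTop 1] with σ h0 h1 h3 h4 hσ1 z H u₁ u₂ hz hz2 hH h hu0 hbc
      rw [div_le_iff₀ hc] at h3
      rw [pow_zero, one_mul] at h1
      have hx : 0 < c * σ := by positivity
      have h0' := h0 z H u₁ u₂ hz hH h hu0
      have hb := (h.bounds hc hβ₁ hβ₂ hq₁ hq₂ hH (by linarith) (by rw [hz]; linarith)
        (⟨zero_le_one, le_rfl⟩ : (1:ℝ) ∈ Icc (0:ℝ) 1)).2.2.2
      have hw := expWeight_le_add (H := H) (κ := c * σ) hx.le (norm_nonneg (u₁ 1))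
        (norm_nonneg (u₂ 0)) (⟨zero_le_one, le_rfl⟩ : (1:ℝ) ∈ Icc (0:ℝ) 1)
      rw [hz, hu0, mul_zero, sub_zero, norm_zero] at hb
      rw [hu0, norm_zero, add_zero] at hw
      have h5 : ‖α₂‖ * ‖u₂ 1‖ ≤ ‖α₁‖ / 4 * (‖u₁ 1‖ + H) := by
        calc ‖α₂‖ * ‖u₂ 1‖ ≤ ‖α₂‖ * ((4 * M + 1) * (‖u₁ 1‖ + H) / (c * σ)) := by
              gcongr
              exact hb.trans (by gcongr)
          _ = ‖α₂‖ * (4 * M + 1) / c / σ * (‖u₁ 1‖ + H) := by field_simp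
          _ ≤ _ := by gcongr
      have h6 : ‖α₁‖ * ‖u₁ 1‖ ≤ ‖α₂‖ * ‖u₂ 1‖ + ‖α₃‖ * ‖u₁ 0‖ := by
        rw [← norm_mul, ← norm_mul, ← norm_mul,
          show α₁ * u₁ 1 = -(α₂ * u₂ 1 + α₃ * u₁ 0) by linear_combination hbc, norm_neg]
        exact norm_add_le _ _
      have h7 := mul_le_mul_of_nonneg_left h0' (norm_nonneg α₃)
      have h8 := mul_le_mul_of_nonneg_right h1 (norm_nonneg (u₁ 1))
      have h9 : ‖α₁‖ * ‖u₁ 1‖ ≤ ‖α₁‖ * ((1 / 2 + 2 * ‖α₃‖ / ‖α₁‖) * H) := by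
        have : ‖α₁‖ * ((1 / 2 + 2 * ‖α₃‖ / ‖α₁‖) * H) = ‖α₁‖ * H / 2 + 2 * ‖α₃‖ * H := by
          field_simp
        rw [this]
        linarith
      refine (le_of_mul_le_mul_left h9 ha₁).trans ?_
      have : 1 ≤ σ ^ (k + 1) := one_le_pow₀ hσ1
      gcongr
      exact le_mul_of_one_le_right (by positivity) this
  obtain ⟨C, hC, hev⟩ := hfst
  refine ⟨4 * C + 4, by positivity, ?_⟩
  filter_upwards [hev, eventually_ge_atTop ((2 * M + 1) / c), eventually_ge_atTop 1]
    with σ hσ h3 hσ1 z H u₁ u₂ hz hz2 hH h hu0 hbc t ht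
  rw [div_le_iff₀ hc] at h3
  have hA := hσ z H u₁ u₂ hz hz2 hH h hu0 hbc
  have hb := h.bounds hc hβ₁ hβ₂ hq₁ hq₂ hH (by linarith) (by rw [hz]; linarith) ht
  rw [hz, hu0, norm_zero] at hb
  have hx : 0 ≤ c * σ := by positivity
  have hw := expWeight_le_add (H := H) hx (norm_nonneg (u₁ 1)) le_rfl ht
  have h7 : H ≤ σ ^ (k + 1) * H := le_mul_of_one_le_left hH.le (one_le_pow₀ hσ1)
  exact ⟨by linarith [hb.1], by linarith [hb.2.1]⟩

end

lemma AnalyticOnNhd.exists_norm_sub_le_at_one {q : ℝ → ℂ} (hq : AnalyticOnNhd ℝ q (Icc 0 1))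
    (h0 : ¬ ∀ x ∈ Icc (0:ℝ) 1, q x = 0) :
    ∃ (g : ℂ) (L : ℝ) (k : ℕ), g ≠ 0 ∧ 0 ≤ L ∧
      ∀ x ∈ Icc (0:ℝ) 1, ‖q x - g * ((1 - x : ℝ) : ℂ) ^ k‖ ≤ L * (1 - x) ^ (k + 1) := by
  have h1 : (1:ℝ) ∈ Icc (0:ℝ) 1 := ⟨zero_le_one, le_rfl⟩
  have hne : ¬ ∀ᶠ x in nhds (1:ℝ), q x = 0 := fun h =>
    h0 (hq.eqOn_zero_of_preconnected_of_eventuallyEq_zero isPreconnected_Icc h1 h)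
  obtain ⟨k, φ, hφ, hφ1, hev⟩ := (hq 1 h1).exists_eventuallyEq_pow_smul_nonzero_iff.2 hne
  obtain ⟨B, hB⟩ := (hφ.differentiableAt.isBigO_sub).bound
  obtain ⟨M, hM⟩ := isCompact_Icc.exists_bound_of_continuousOn (f := q) hq.continuousOn
  obtain ⟨δ, hδ, hball⟩ := Metric.eventually_nhds_iff_ball.1 (hev.and hB)
  set g : ℂ := (-1) ^ k * φ 1 with hg
  have hM0 : 0 ≤ M := (norm_nonneg _).trans (hM 1 h1)
  refine ⟨g, max B ((M + ‖g‖) / δ ^ (k + 1)), k, by simp [hg, hφ1],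
    le_max_of_le_right (by positivity), fun x hx => ?_⟩
  have hx1 : 0 ≤ 1 - x := by linarith [hx.2]
  rcases lt_or_ge (1 - x) δ with h | h
  · have hxb : x ∈ Metric.ball (1:ℝ) δ := by
      rw [Metric.mem_ball, Real.dist_eq, abs_sub_comm, abs_of_nonneg hx1]; exact h
    obtain ⟨e1, e2⟩ := hball x hxb
    have e3 : q x - g * ((1 - x : ℝ) : ℂ) ^ k = ((1 - x : ℝ) : ℂ) ^ k * ((-1) ^ k * (φ x - φ 1)) := by
      rw [e1, hg, Complex.real_smul]
      have : (((x - 1) ^ k : ℝ) : ℂ) = ((1 - x : ℝ) : ℂ) ^ k * (-1) ^ k := by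
        rw [← mul_pow]; push_cast; ring
      rw [this]; ring
    rw [Real.norm_eq_abs, abs_sub_comm, abs_of_nonneg hx1] at e2
    rw [e3, norm_mul, norm_mul, norm_pow, norm_pow, norm_neg, norm_one, one_pow, one_mul,
      Complex.norm_real, Real.norm_of_nonneg hx1]
    calc _ ≤ (1 - x) ^ k * (B * (1 - x)) := by gcongr
      _ = B * (1 - x) ^ (k + 1) := by ring
      _ ≤ _ := by gcongr; exact le_max_left _ _
  · have e1 : ‖g * ((1 - x : ℝ) : ℂ) ^ k‖ ≤ ‖g‖ := by
      rw [norm_mul, norm_pow, Complex.norm_real, Real.norm_of_nonneg hx1]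
      exact mul_le_of_le_one_right (norm_nonneg _) (pow_le_one₀ hx1 (by linarith [hx.1]))
    calc _ ≤ M + ‖g‖ := (norm_sub_le _ _).trans (add_le_add (hM x hx) e1)
      _ = (M + ‖g‖) / δ ^ (k + 1) * δ ^ (k + 1) := by field_simp
      _ ≤ (M + ‖g‖) / δ ^ (k + 1) * (1 - x) ^ (k + 1) := by gcongr
      _ ≤ _ := by gcongr; exact le_max_right _ _

lemma AnalyticOnNhd.reflect_unitInterval {q : ℝ → ℂ} (hq : AnalyticOnNhd ℝ q (Icc 0 1)) :
    AnalyticOnNhd ℝ (fun x => -q (1 - x)) (Icc 0 1) := by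
  intro x hx
  have h1 : AnalyticAt ℝ q (1 - x) := hq (1 - x) ⟨by linarith [hx.2], by linarith [hx.1]⟩
  have h2 : AnalyticAt ℝ (fun y : ℝ => 1 - y) x := by fun_prop
  exact (h1.fun_comp h2).neg

lemma exists_norm_le_of_diagonal {β₁ β₂ : ℝ} (hβ₁ : 0 < β₁) (hβ₂ : 0 < β₂) {q₁ q₂ : ℝ → ℂ}
    (hq₁ : AnalyticOnNhd ℝ q₁ (Icc 0 1)) (hq₂ : AnalyticOnNhd ℝ q₂ (Icc 0 1))
    (h0 : ¬ ∀ x ∈ Icc (0:ℝ) 1, q₂ x = 0) {α₁ α₂ α₃ : ℂ} (hα₂ : α₂ ≠ 0) :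
    ∃ (C ρ : ℝ) (N : ℕ), 0 < C ∧ ∀ (z : ℂ) (H : ℝ) (u₁ u₂ : ℝ → ℂ), ρ ≤ ‖z‖ →
      |z.re| = |z.im| → 0 < H → ApproxSolution β₁ β₂ q₁ q₂ z H u₁ u₂ → u₂ 1 = 0 →
      α₁ * u₁ 0 + α₂ * u₂ 0 + α₃ * u₁ 1 = 0 →
      ∀ t ∈ Icc (0:ℝ) 1, ‖u₁ t‖ ≤ C * (1 + ‖z‖) ^ N * H ∧ ‖u₂ t‖ ≤ C * (1 + ‖z‖) ^ N * H := by
  have hc : 0 < min β₁ β₂ / 2 := half_pos (lt_min hβ₁ hβ₂)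
  have hb₁ : 2 * (min β₁ β₂ / 2) ≤ β₁ := by linarith [min_le_left β₁ β₂]
  have hb₂ : 2 * (min β₁ β₂ / 2) ≤ β₂ := by linarith [min_le_right β₁ β₂]
  obtain ⟨M₁, hM₁⟩ := isCompact_Icc.exists_bound_of_continuousOn (f := q₁) hq₁.continuousOn
  obtain ⟨M₂, hM₂⟩ := isCompact_Icc.exists_bound_of_continuousOn (f := q₂) hq₂.continuousOn
  have hr : ∀ {x : ℝ}, x ∈ Icc (0:ℝ) 1 → 1 - x ∈ Icc (0:ℝ) 1 := fun hx =>
    ⟨by linarith [hx.2], by linarith [hx.1]⟩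
  obtain ⟨g, L, k, hg, hL, hgL⟩ := hq₂.exists_norm_sub_le_at_one h0
  obtain ⟨g', L', k', hg', hL', hgL'⟩ := hq₂.reflect_unitInterval.exists_norm_sub_le_at_one
    (fun h => h0 fun x hx => by simpa using h (1 - x) (hr hx))
  obtain ⟨C, hC, hev⟩ := exists_eventually_norm_le_of_snd_one_eq_zero (M := max M₁ M₂) hc hb₁ hb₂
    (fun x hx => (hM₁ x hx).trans (le_max_left _ _))
    (fun x hx => (hM₂ x hx).trans (le_max_right _ _)) hg hL hgL (α₁ := α₁) (α₃ := α₃) hα₂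
  obtain ⟨C', hC', hev'⟩ := exists_eventually_norm_le_of_snd_zero_eq_zero (M := max M₁ M₂)
    hc hb₁ hb₂ (q₁ := fun x => -q₁ (1 - x))
    (fun x hx => by rw [norm_neg]; exact (hM₁ _ (hr hx)).trans (le_max_left _ _))
    (fun x hx => by rw [norm_neg]; exact (hM₂ _ (hr hx)).trans (le_max_right _ _))
    hg' hL' hgL' (α₁ := α₁) (α₃ := α₃) hα₂
  obtain ⟨σ₀, hσ₀⟩ := eventually_atTop.1 (hev.and hev')
  have hpow : ∀ {σ r : ℝ} {j : ℕ} {D : ℝ}, 0 ≤ σ → σ ≤ r → j ≤ k + k' → 0 ≤ D → D ≤ C + C' →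
      D * σ ^ (j + 1) ≤ (C + C') * (1 + r) ^ (k + k' + 1) := by
    intro σ r j D hσ hσr hj hD hDC
    have h1 : σ ^ (j + 1) ≤ (1 + r) ^ (k + k' + 1) :=
      (pow_le_pow_left₀ hσ (by linarith) _).trans
        (pow_le_pow_right₀ (by linarith) (by omega))
    gcongr
  refine ⟨C + C', 2 * max σ₀ 1, k + k' + 1, by positivity,
    fun z H u₁ u₂ hz hd hH h hu hbc t ht => ?_⟩
  have hzn : ‖z‖ ≤ 2 * |z.re| := by
    have := Complex.norm_le_abs_re_add_abs_im z
    rw [← hd] at this; linarith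
  have hre := Complex.abs_re_le_norm z
  have h1 : σ₀ ≤ |z.re| := by linarith [le_max_left σ₀ 1]
  have h2 : 1 ≤ |z.re| := by linarith [le_max_right σ₀ 1]
  obtain ⟨hA, hB⟩ := hσ₀ _ h1
  rcases le_total 0 z.re with hs | hs
  · rw [abs_of_nonneg hs] at *
    obtain ⟨e1, e2⟩ := hA z H u₁ u₂ rfl hzn hH h hu hbc t ht
    have := mul_le_mul_of_nonneg_right (hpow hs hre (Nat.le_add_right k k') hC.le
      (by linarith)) hH.le
    exact ⟨e1.trans this, e2.trans this⟩
  · rw [abs_of_nonpos hs] at *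
    obtain ⟨e1, e2⟩ := hB (-z) H _ _ (by simp) (by rwa [norm_neg]) hH h.reflect
      (by simpa using hu) (by simpa using hbc) (1 - t) (hr ht)
    have := mul_le_mul_of_nonneg_right (hpow (by linarith) hre (Nat.le_add_left k' k) hC'.le
      (by linarith)) hH.le
    rw [sub_sub_cancel] at e1 e2
    exact ⟨e1.trans this, e2.trans this⟩

lemma exists_entire_resolvent {A : Type*} [NormedRing A] [NormedAlgebra ℂ A] [CompleteSpace A]
    {V₀ V₁ : A} {M : ℝ}
    (hV : ∀ (z : ℂ) (n : ℕ), ‖(V₀ + z • V₁) ^ n‖ ≤ (M * (1 + ‖z‖)) ^ n / n.factorial) :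
    ∃ R : ℂ → A, Differentiable ℂ R ∧ (∀ z, R z * (1 - (V₀ + z • V₁)) = 1) ∧
      (∀ z, (1 - (V₀ + z • V₁)) * R z = 1) ∧ ∀ z, ‖R z‖ ≤ Real.exp (M * (1 + ‖z‖)) := by
  have hs : ∀ z : ℂ, HasSum (fun n : ℕ => (M * (1 + ‖z‖)) ^ n / n.factorial)
      (Real.exp (M * (1 + ‖z‖))) := fun z => by
    have := NormedSpace.expSeries_div_hasSum_exp (M * (1 + ‖z‖))
    rwa [← Real.exp_eq_exp_ℝ] at this
  have hsum : ∀ z : ℂ, Summable fun n : ℕ => (V₀ + z • V₁) ^ n := fun z =>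
    Summable.of_norm_bounded (hs z).summable (hV z)
  have hl : ∀ z : ℂ, (∑' n : ℕ, (V₀ + z • V₁) ^ n) * (1 - (V₀ + z • V₁)) = 1 := fun z =>
    (hsum z).tsum_pow_mul_one_sub
  have hr : ∀ z : ℂ, (1 - (V₀ + z • V₁)) * (∑' n : ℕ, (V₀ + z • V₁) ^ n) = 1 := fun z =>
    (hsum z).one_sub_mul_tsum_pow
  refine ⟨fun z => ∑' n : ℕ, (V₀ + z • V₁) ^ n, fun z => ?_, hl, hr, fun z =>
    tsum_of_norm_bounded (hs z) (hV z)⟩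
  have hu : ∀ z : ℂ, IsUnit (1 - (V₀ + z • V₁)) := fun z => ⟨⟨_, _, hr z, hl z⟩, rfl⟩
  have heq : (fun z : ℂ => ∑' n : ℕ, (V₀ + z • V₁) ^ n) =
      fun z => Ring.inverse (1 - (V₀ + z • V₁)) := by
    funext w
    have h1 := Ring.mul_inverse_cancel _ (hu w)
    calc _ = (∑' n : ℕ, (V₀ + w • V₁) ^ n) *
          ((1 - (V₀ + w • V₁)) * Ring.inverse (1 - (V₀ + w • V₁))) := by rw [h1, mul_one]
      _ = _ := by rw [← mul_assoc, hl, one_mul]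
  rw [heq]
  have hd : DifferentiableAt ℂ (fun z : ℂ => 1 - (V₀ + z • V₁)) z := by fun_prop
  exact DifferentiableAt.comp z (differentiableAt_inverse (𝕜 := ℂ) (hu z)) hd

section Pencil

variable {E : Type*} [NormedAddCommGroup E] [NormedSpace ℂ E]

lemma resolvent_apply_eq_sum {V₀ V₁ : E →L[ℂ] E} {R : ℂ → E →L[ℂ] E}
    (hl : ∀ z, R z * (1 - (V₀ + z • V₁)) = 1) (hr : ∀ z, (1 - (V₀ + z • V₁)) * R z = 1)
    (z₀ z : ℂ) (e : E) (n : ℕ) :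
    R z e = ∑ j ∈ Finset.range n, (z - z₀) ^ j • R z₀ (((V₁ * R z₀) ^ j) e) +
      (z - z₀) ^ n • R z (((V₁ * R z₀) ^ n) e) := by
  have key : ∀ w, R z w = R z₀ w + (z - z₀) • R z (V₁ (R z₀ w)) := by
    have h : R z - R z₀ = (z - z₀) • (R z * V₁ * R z₀) := by
      calc R z - R z₀ = R z * ((1 - (V₀ + z₀ • V₁)) * R z₀) -
            (R z * (1 - (V₀ + z • V₁))) * R z₀ := by rw [hl, hr, mul_one, one_mul]
        _ = R z * (((1 - (V₀ + z₀ • V₁)) - (1 - (V₀ + z • V₁))) * R z₀) := by noncomm_ring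
        _ = R z * (((z - z₀) • V₁) * R z₀) := by congr 2; rw [sub_smul]; abel
        _ = _ := by simp [mul_assoc]
    intro w
    have := congrArg (fun T : E →L[ℂ] E => T w) h
    simp only [sub_apply, smul_apply,
      mul_apply_eq_comp] at this
    rw [← this]; abel
  induction n with
  | zero => simp
  | succ n ih =>
    rw [Finset.sum_range_succ, add_assoc]
    conv_lhs => rw [ih]
    congr 1
    conv_lhs => rw [key]
    rw [smul_add, smul_smul, ← pow_succ]
    congr 3
    rw [pow_succ']; rfl

variable {V₀ V₁ : E →L[ℂ] E} {R : ℂ → E →L[ℂ] E}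

lemma differentiable_resolvent_apply (hR : Differentiable ℂ R) (φ : E →L[ℂ] ℂ) (w : E) :
    Differentiable ℂ fun z => φ (R z w) := by
  intro z
  have := (hR z).clm_apply (differentiableAt_const w)
  exact φ.differentiableAt.comp z this

lemma apply_chain_eq_zero_of_le_order (hR : Differentiable ℂ R)
    (hl : ∀ z, R z * (1 - (V₀ + z • V₁)) = 1) (hr : ∀ z, (1 - (V₀ + z • V₁)) * R z = 1)
    (U : E →L[ℂ] ℂ) (e : E) (z₀ : ℂ) (n : ℕ)
    (hn : (n : ℕ∞) ≤ analyticOrderAt (fun z => U (R z e)) z₀) :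
    ∀ j < n, U (R z₀ (((V₁ * R z₀) ^ j) e)) = 0 := by
  induction n with
  | zero => intro j hj; omega
  | succ n ih =>
    have ih' := ih (le_trans (by exact_mod_cast Nat.le_succ n) hn)
    intro j hj
    rcases Nat.lt_succ_iff_lt_or_eq.1 hj with h | rfl
    · exact ih' j h
    have hf : (fun z => U (R z e)) =
        (fun z => (z - z₀) ^ j) * (fun z => U (R z (((V₁ * R z₀) ^ j) e))) := by
      funext z
      rw [resolvent_apply_eq_sum hl hr z₀ z e j]
      simp only [map_add, map_sum, map_smul, smul_eq_mul, Pi.mul_apply]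
      rw [Finset.sum_eq_zero (fun i hi => by rw [ih' i (Finset.mem_range.1 hi), mul_zero]),
        zero_add]
    have ha : AnalyticAt ℂ (fun z => U (R z (((V₁ * R z₀) ^ j) e))) z₀ :=
      (differentiable_resolvent_apply hR U _).analyticAt z₀
    have hp : AnalyticAt ℂ (fun z : ℂ => (z - z₀) ^ j) z₀ := by fun_prop
    rw [hf, analyticOrderAt_mul hp ha] at hn
    have ho : analyticOrderAt (fun z : ℂ => (z - z₀) ^ j) z₀ = j := by
      rw [hp.analyticOrderAt_eq_natCast]
      exact ⟨fun _ => 1, analyticAt_const, one_ne_zero, by simp⟩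
    rw [ho] at hn
    refine (ha.analyticOrderAt_ne_zero).1 fun h0 => ?_
    rw [h0, add_zero] at hn
    have : j + 1 ≤ j := by exact_mod_cast hn
    omega

lemma analyticOrderAt_le_of_chains (hR : Differentiable ℂ R)
    (hl : ∀ z, R z * (1 - (V₀ + z • V₁)) = 1) (hr : ∀ z, (1 - (V₀ + z • V₁)) * R z = 1)
    (U F : E →L[ℂ] ℂ) (e : E)
    (hchain : ∀ (z : ℂ) (ch : ℕ → E), ch 0 = (V₀ + z • V₁) (ch 0) + e →
      (∀ j, ch (j + 1) = (V₀ + z • V₁) (ch (j + 1)) + V₁ (ch j)) →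
      ∀ m, (∀ j ≤ m, U (ch j) = 0) → F (ch m) = 0) (z₀ : ℂ) :
    analyticOrderAt (fun z => U (R z e)) z₀ ≤ analyticOrderAt (fun z => F (R z e)) z₀ := by
  refine ENat.forall_natCast_le_iff_le.1 fun n hn => ?_
  have h0 := apply_chain_eq_zero_of_le_order hR hl hr U e z₀ n hn
  have hR0 : ∀ w, R z₀ w = (V₀ + z₀ • V₁) (R z₀ w) + w := fun w => by
    have := congrArg (fun T : E →L[ℂ] E => T w) (hr z₀)
    simp only [sub_mul, one_mul, sub_apply, mul_apply_eq_comp,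
      one_apply_eq_self] at this
    rw [sub_eq_iff_eq_add'] at this
    exact this
  have hF : ∀ j < n, F (R z₀ (((V₁ * R z₀) ^ j) e)) = 0 := by
    intro j hj
    refine hchain z₀ (fun j => R z₀ (((V₁ * R z₀) ^ j) e)) ?_ ?_ j
      fun i hi => h0 i (lt_of_le_of_lt hi hj)
    · simpa using hR0 e
    · intro i
      have := hR0 (((V₁ * R z₀) ^ (i + 1)) e)
      rw [pow_succ'] at this ⊢
      exact this
  rw [natCast_le_analyticOrderAt ((differentiable_resolvent_apply hR F e).analyticAt z₀)]
  refine ⟨fun z => F (R z (((V₁ * R z₀) ^ n) e)),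
    (differentiable_resolvent_apply hR F _).analyticAt z₀, .of_forall fun z => ?_⟩
  rw [resolvent_apply_eq_sum hl hr z₀ z e n]
  simp only [map_add, map_sum, map_smul, smul_eq_mul]
  rw [Finset.sum_eq_zero (fun i hi => by rw [hF i (Finset.mem_range.1 hi), mul_zero]), zero_add]

lemma exists_norm_resolvent_apply_le_exp {M : ℝ} (hM : 0 ≤ M)
    (hR : ∀ z, ‖R z‖ ≤ Real.exp (M * (1 + ‖z‖))) (φ : E →L[ℂ] ℂ) (w : E) :
    ∃ C, 0 ≤ C ∧ ∀ z, ‖φ (R z w)‖ ≤ Real.exp (C * (1 + ‖z‖)) := by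
  refine ⟨‖φ‖ * ‖w‖ + M, by positivity, fun z => ?_⟩
  have h1 : ‖φ (R z w)‖ ≤ ‖φ‖ * ‖w‖ * Real.exp (M * (1 + ‖z‖)) :=
    calc _ ≤ ‖φ‖ * ‖R z w‖ := φ.le_opNorm _
      _ ≤ ‖φ‖ * (‖R z‖ * ‖w‖) := by gcongr; exact (R z).le_opNorm _
      _ ≤ ‖φ‖ * (Real.exp (M * (1 + ‖z‖)) * ‖w‖) := by gcongr; exact hR z
      _ = _ := by ring
  have h2 : ‖φ‖ * ‖w‖ ≤ Real.exp (‖φ‖ * ‖w‖ * (1 + ‖z‖)) := by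
    have := Real.add_one_le_exp (‖φ‖ * ‖w‖ * (1 + ‖z‖))
    have h3 : ‖φ‖ * ‖w‖ ≤ ‖φ‖ * ‖w‖ * (1 + ‖z‖) :=
      le_mul_of_one_le_right (by positivity) (by linarith [norm_nonneg z])
    linarith
  calc _ ≤ _ := h1
    _ ≤ Real.exp (‖φ‖ * ‖w‖ * (1 + ‖z‖)) * Real.exp (M * (1 + ‖z‖)) := by gcongr
    _ = _ := by rw [← Real.exp_add]; ring_nf

theorem functional_eq_zero_of_chains_of_ray_bound [CompleteSpace E] {M : ℝ} (hM : 0 ≤ M)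
    (hV : ∀ (z : ℂ) (n : ℕ), ‖(V₀ + z • V₁) ^ n‖ ≤ (M * (1 + ‖z‖)) ^ n / n.factorial)
    (U F : E →L[ℂ] ℂ) {e : E} (he : e ≠ 0)
    (hchain : ∀ (z : ℂ) (ch : ℕ → E), ch 0 = (V₀ + z • V₁) (ch 0) + e →
      (∀ j, ch (j + 1) = (V₀ + z • V₁) (ch (j + 1)) + V₁ (ch j)) →
      ∀ m, (∀ j ≤ m, U (ch j) = 0) → F (ch m) = 0)
    {C ρ : ℝ} {N : ℕ}
    (hray : ∀ z : ℂ, ρ ≤ ‖z‖ → |z.re| = |z.im| → ∀ (c : ℂ) (h u : E),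
      u = (V₀ + z • V₁) u + (V₁ h + c • e) → U u = 0 → ‖u‖ ≤ C * (1 + ‖z‖) ^ N * ‖h‖)
    (h : ℕ → E) (hh : ∀ n, V₁ (h (n + 1)) = h n - V₀ (h n)) (hU : ∀ n, U (h n) = 0) :
    F (h 0) = 0 := by
  obtain ⟨R, hR, hl, hr, hRb⟩ := exists_entire_resolvent hV
  have hRr : ∀ z w, R z w = (V₀ + z • V₁) (R z w) + w := fun z w => by
    have := congrArg (fun T : E →L[ℂ] E => T w) (hr z)
    simp only [sub_mul, one_mul, sub_apply, mul_apply_eq_comp,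
      one_apply_eq_self] at this
    rw [sub_eq_iff_eq_add'] at this
    exact this
  have hRl : ∀ z w, R z (w - (V₀ + z • V₁) w) = w := fun z w => by
    have := congrArg (fun T : E →L[ℂ] E => T w) (hl z)
    simpa using this
  have hD0 : ∀ z : ℂ, ρ ≤ ‖z‖ → |z.re| = |z.im| → U (R z e) ≠ 0 := by
    intro z hz hd h0
    have h1 := hray z hz hd 1 0 (R z e) (by simpa using hRr z e) h0
    have h2 : R z e = 0 := by simpa using h1
    have h3 := hRr z e
    rw [h2, map_zero, zero_add] at h3
    exact he h3.symm
  have hdiag : ∀ s : ℝ, 0 ≤ s → ρ ≤ s → ρ ≤ ‖(⟨s, s⟩ : ℂ)‖ := fun s hs h =>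
    h.trans ((le_abs_self s).trans (Complex.abs_re_le_norm ⟨s, s⟩))
  have hc := hD0 (⟨max ρ 0, max ρ 0⟩ : ℂ) (hdiag _ (le_max_right _ _) (le_max_left _ _)) rfl
  obtain ⟨Q, hQ, hQm⟩ := exists_differentiable_quotient
    (differentiable_resolvent_apply hR F e) (D := fun z => U (R z e))
    (differentiable_resolvent_apply hR U e) hc
    (analyticOrderAt_le_of_chains hR hl hr U F e hchain)
  obtain ⟨C₁, hC₁, hF₁⟩ := exists_norm_resolvent_apply_le_exp hM hRb F e
  obtain ⟨C₂, hC₂, hU₂⟩ := exists_norm_resolvent_apply_le_exp hM hRb U e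
  obtain ⟨K, hK, hQK⟩ := exists_norm_quotient_le_exp hQ (differentiable_resolvent_apply hR F e)
    (differentiable_resolvent_apply hR U e) hQm (C := C₁ + C₂)
    (fun z => (hF₁ z).trans (Real.exp_le_exp.2 (by gcongr; linarith)))
    (fun z => (hU₂ z).trans (Real.exp_le_exp.2 (by gcongr; linarith))) hc (by positivity)
  have hm : ∀ w, Differentiable ℂ fun z => F (R z w) - U (R z w) * Q z := fun w =>
    (differentiable_resolvent_apply hR F w).sub
      ((differentiable_resolvent_apply hR U w).mul hQ)
  refine eq_zero_of_affine_recursion (N := N)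
    (m := fun n z => F (R z (V₁ (h n))) - U (R z (V₁ (h n))) * Q z)
    (c := fun n => F (h n)) (fun n => hm _) (fun n z => ?_) (fun n => ?_) 0
  · have h1 : R z (V₁ (h (n + 1))) = z • R z (V₁ (h n)) + h n := by
      have : V₁ (h (n + 1)) = (h n - (V₀ + z • V₁) (h n)) + z • V₁ (h n) := by
        rw [hh]; simp; abel
      rw [this, map_add, hRl, map_smul, add_comm]
    simp only [h1, map_add, map_smul, hU, smul_eq_mul, add_zero]
    ring
  · obtain ⟨A₁, hA₁, hF'⟩ := exists_norm_resolvent_apply_le_exp hM hRb F (V₁ (h n))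
    obtain ⟨A₂, hA₂, hU'⟩ := exists_norm_resolvent_apply_le_exp hM hRb U (V₁ (h n))
    refine exists_polynomial_bound_of_diagonal_bound (hm _) (K := A₁ + A₂ + K + 1) (R := ρ)
      (C := ‖F‖ * C * ‖h n‖) (fun z => ?_) (fun z hz hd => ?_)
    · have hz := norm_nonneg z
      have e1 : Real.exp (A₁ * (1 + ‖z‖)) ≤ Real.exp ((A₁ + A₂ + K) * (1 + ‖z‖)) :=
        Real.exp_le_exp.2 (by gcongr; linarith)
      have e2 : Real.exp (A₂ * (1 + ‖z‖)) * Real.exp (K * (1 + ‖z‖)) ≤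
          Real.exp ((A₁ + A₂ + K) * (1 + ‖z‖)) := by
        rw [← Real.exp_add]
        refine Real.exp_le_exp.2 ?_
        nlinarith [mul_nonneg hA₁ (by linarith : 0 ≤ 1 + ‖z‖)]
      have e3 : (2 : ℝ) ≤ Real.exp (1 * (1 + ‖z‖)) := by
        have := Real.add_one_le_exp (1 * (1 + ‖z‖)); linarith
      calc _ ≤ ‖F (R z (V₁ (h n)))‖ + ‖U (R z (V₁ (h n)))‖ * ‖Q z‖ := by
            rw [← norm_mul]; exact norm_sub_le _ _
        _ ≤ Real.exp (A₁ * (1 + ‖z‖)) + Real.exp (A₂ * (1 + ‖z‖)) * Real.exp (K * (1 + ‖z‖)) := by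
            gcongr
            · exact hF' z
            · exact hU' z
            · exact hQK z
        _ ≤ 2 * Real.exp ((A₁ + A₂ + K) * (1 + ‖z‖)) := by linarith
        _ ≤ Real.exp (1 * (1 + ‖z‖)) * Real.exp ((A₁ + A₂ + K) * (1 + ‖z‖)) := by gcongr
        _ = _ := by rw [← Real.exp_add]; ring_nf
    · have hD := hD0 z hz hd
      set p := R z (V₁ (h n)) with hp
      set c : ℂ := -(U p / U (R z e)) with hcdef
      have h1 := hray z hz hd c (h n) (p + c • R z e) (by
          conv_lhs => rw [hp, hRr z (V₁ (h n)), hRr z e]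
          rw [map_add, map_smul, smul_add]
          abel) (by
          rw [map_add, map_smul, smul_eq_mul, hcdef]; field_simp; ring)
      have h2 : F p - U p * Q z = F (p + c • R z e) := by
        rw [map_add, map_smul, smul_eq_mul, ← hQm z, hcdef]; field_simp; ring
      rw [h2]
      calc _ ≤ ‖F‖ * ‖p + c • R z e‖ := F.le_opNorm _
        _ ≤ ‖F‖ * (C * (1 + ‖z‖) ^ N * ‖h n‖) := by gcongr
        _ = _ := by ring

end Pencil

section Volterra

variable {W : Type*} [NormedAddCommGroup W] [NormedSpace ℂ W]

lemma ContinuousMap.continuous_apply_projIcc (A : C(Icc (0:ℝ) 1, W →L[ℂ] W))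
    (u : C(Icc (0:ℝ) 1, W)) :
    Continuous fun t : ℝ => A (projIcc 0 1 zero_le_one t) (u (projIcc 0 1 zero_le_one t)) := by
  fun_prop

/-- The operator `u ↦ ∫ t in 1..x, A t (u t)` on continuous functions on `[0,1]`. -/
def volterra (A : C(Icc (0:ℝ) 1, W →L[ℂ] W)) : C(Icc (0:ℝ) 1, W) →L[ℂ] C(Icc (0:ℝ) 1, W) :=
  LinearMap.mkContinuous
    { toFun := fun u => ⟨fun x => ∫ t in (1:ℝ)..x,
          A (projIcc 0 1 zero_le_one t) (u (projIcc 0 1 zero_le_one t)),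
          (intervalIntegral.continuous_primitive
            (fun a b => (A.continuous_apply_projIcc u).intervalIntegrable a b) 1).comp
            continuous_subtype_val⟩
      map_add' := fun u v => by
        ext x
        simp only [ContinuousMap.add_apply, map_add, ContinuousMap.coe_mk]
        exact intervalIntegral.integral_add ((A.continuous_apply_projIcc u).intervalIntegrable _ _)
          ((A.continuous_apply_projIcc v).intervalIntegrable _ _)
      map_smul' := fun c u => by
        ext x
        simp only [ContinuousMap.smul_apply, map_smul, ContinuousMap.coe_mk, RingHom.id_apply]
        exact intervalIntegral.integral_smul c _ } ‖A‖ (fun u => by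
    refine (ContinuousMap.norm_le _ (by positivity)).2 fun x => ?_
    refine (intervalIntegral.norm_integral_le_of_norm_le_const (C := ‖A‖ * ‖u‖)
      fun t _ => ?_).trans ?_
    · exact ((A _).le_opNorm _).trans
        (mul_le_mul (A.norm_coe_le_norm _) (u.norm_coe_le_norm _) (norm_nonneg _) (norm_nonneg A))
    · refine mul_le_of_le_one_right (by positivity) ?_
      rw [abs_le]; constructor <;> linarith [x.2.1, x.2.2])

lemma volterra_apply (A : C(Icc (0:ℝ) 1, W →L[ℂ] W)) (u : C(Icc (0:ℝ) 1, W))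
    (x : Icc (0:ℝ) 1) : volterra A u x = ∫ t in (1:ℝ)..x,
      A (projIcc 0 1 zero_le_one t) (u (projIcc 0 1 zero_le_one t)) := rfl

lemma volterra_add_smul (A B : C(Icc (0:ℝ) 1, W →L[ℂ] W)) (z : ℂ) :
    volterra A + z • volterra B = volterra (A + z • B) := by
  ext u x
  simp only [add_apply, smul_apply, ContinuousMap.add_apply, ContinuousMap.smul_apply,
    volterra_apply]
  rw [← intervalIntegral.integral_smul, ← intervalIntegral.integral_add]
  · exact (A.continuous_apply_projIcc u).intervalIntegrable _ _
  · exact ((B.continuous_apply_projIcc u).const_smul z).intervalIntegrable _ _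

lemma norm_volterra_pow_apply_le (A : C(Icc (0:ℝ) 1, W →L[ℂ] W)) (u : C(Icc (0:ℝ) 1, W)) (n : ℕ)
    (x : Icc (0:ℝ) 1) :
    ‖(volterra A ^ n) u x‖ ≤ ‖A‖ ^ n * ‖u‖ * ((1 - x) ^ n / n.factorial) := by
  induction n generalizing x with
  | zero => simpa using u.norm_coe_le_norm x
  | succ n ih =>
    rw [pow_succ', mul_apply_eq_comp, volterra_apply, intervalIntegral.integral_symm, norm_neg]
    have hle : ∀ t ∈ Ioc (x:ℝ) 1, ‖A (projIcc 0 1 zero_le_one t)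
        ((volterra A ^ n) u (projIcc 0 1 zero_le_one t))‖ ≤
        ‖A‖ ^ (n + 1) * ‖u‖ * ((1 - t) ^ n / n.factorial) := fun t ht => by
      have ht' : t ∈ Icc (0:ℝ) 1 := ⟨x.2.1.trans ht.1.le, ht.2⟩
      have := ih (projIcc 0 1 zero_le_one t)
      rw [projIcc_of_mem _ ht'] at this ⊢
      calc _ ≤ ‖A‖ * (‖A‖ ^ n * ‖u‖ * ((1 - t) ^ n / n.factorial)) :=
            ((A _).le_opNorm _).trans (mul_le_mul (A.norm_coe_le_norm _) this (norm_nonneg _)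
              (norm_nonneg A))
        _ = _ := by ring
    refine (intervalIntegral.norm_integral_le_of_norm_le x.2.2 (.of_forall hle)
      (Continuous.intervalIntegrable (by fun_prop) _ _)).trans (le_of_eq ?_)
    rw [intervalIntegral.integral_const_mul, intervalIntegral.integral_div,
      intervalIntegral.integral_comp_sub_left (fun t : ℝ => t ^ n) 1, integral_pow,
      Nat.factorial_succ]
    push_cast
    rw [sub_self, zero_pow n.succ_ne_zero, sub_zero]
    field_simp

lemma norm_volterra_pow_le (A : C(Icc (0:ℝ) 1, W →L[ℂ] W)) (n : ℕ) :
    ‖volterra A ^ n‖ ≤ ‖A‖ ^ n / n.factorial := by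
  refine ContinuousLinearMap.opNorm_le_bound _ (by positivity) fun u => ?_
  refine (ContinuousMap.norm_le _ (by positivity)).2 fun x => ?_
  calc _ ≤ _ := norm_volterra_pow_apply_le A u n x
    _ ≤ ‖A‖ ^ n * ‖u‖ * (1 / n.factorial) := by
      have h1 : (0:ℝ) ≤ 1 - x := by linarith [x.2.2]
      have : (1 - (x:ℝ)) ^ n ≤ 1 := pow_le_one₀ h1 (by linarith [x.2.1])
      gcongr
    _ = _ := by ring

lemma norm_volterra_pencil_pow_le (A B : C(Icc (0:ℝ) 1, W →L[ℂ] W)) (z : ℂ) (n : ℕ) :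
    ‖(volterra A + z • volterra B) ^ n‖ ≤ ((‖A‖ + ‖B‖) * (1 + ‖z‖)) ^ n / n.factorial := by
  rw [volterra_add_smul]
  refine (norm_volterra_pow_le _ n).trans ?_
  have : ‖A + z • B‖ ≤ (‖A‖ + ‖B‖) * (1 + ‖z‖) := by
    have hz : ‖z • B‖ ≤ ‖z‖ * ‖B‖ := by
      refine (ContinuousMap.norm_le _ (by positivity)).2 fun x => ?_
      rw [ContinuousMap.smul_apply, norm_smul]
      exact mul_le_mul_of_nonneg_left (B.norm_coe_le_norm x) (norm_nonneg z)
    refine (norm_add_le A (z • B)).trans ?_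
    nlinarith [norm_nonneg A, norm_nonneg B, norm_nonneg z, mul_nonneg (norm_nonneg A) (norm_nonneg z)]
  gcongr

end Volterra

/-- The matrix coefficient with off-diagonal entries `q₁`, `q₂`. -/
def offDiagonal (q₁ q₂ : C(Icc (0:ℝ) 1, ℂ)) : C(Icc (0:ℝ) 1, ℂ × ℂ →L[ℂ] ℂ × ℂ) where
  toFun x := q₁ x • (ContinuousLinearMap.snd ℂ ℂ ℂ).prod (0 : ℂ × ℂ →L[ℂ] ℂ) +
    q₂ x • (0 : ℂ × ℂ →L[ℂ] ℂ).prod (ContinuousLinearMap.fst ℂ ℂ ℂ)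

lemma offDiagonal_apply (q₁ q₂ : C(Icc (0:ℝ) 1, ℂ)) (x : Icc (0:ℝ) 1) (w : ℂ × ℂ) :
    offDiagonal q₁ q₂ x w = (q₁ x * w.2, q₂ x * w.1) := by
  simp [offDiagonal]

/-- The constant diagonal matrix coefficient. -/
def constDiagonal (d₁ d₂ : ℂ) : C(Icc (0:ℝ) 1, ℂ × ℂ →L[ℂ] ℂ × ℂ) :=
  ContinuousMap.const _ (d₁ • (ContinuousLinearMap.fst ℂ ℂ ℂ).prod (0 : ℂ × ℂ →L[ℂ] ℂ) +
    d₂ • (0 : ℂ × ℂ →L[ℂ] ℂ).prod (ContinuousLinearMap.snd ℂ ℂ ℂ))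

lemma constDiagonal_apply (d₁ d₂ : ℂ) (x : Icc (0:ℝ) 1) (w : ℂ × ℂ) :
    constDiagonal d₁ d₂ x w = (d₁ * w.1, d₂ * w.2) := by
  simp [constDiagonal]

/-- Extension of a continuous function on `[0,1]` to the line, constant outside. -/
def extendIcc {W : Type*} [TopologicalSpace W] (u : C(Icc (0:ℝ) 1, W)) : C(ℝ, W) :=
  ⟨fun t => u (projIcc 0 1 zero_le_one t), by fun_prop⟩

lemma extendIcc_of_mem {W : Type*} [TopologicalSpace W] (u : C(Icc (0:ℝ) 1, W)) {x : ℝ}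
    (hx : x ∈ Icc (0:ℝ) 1) : extendIcc u x = u ⟨x, hx⟩ := by
  simp [extendIcc, projIcc_of_mem _ hx]

section Dirac

variable {b₁ b₂ : ℝ} {Q12 Q21 : ℝ → ℂ}

/-- The restriction of a continuous function to `[0,1]`. -/
def restrictIcc (q : ℝ → ℂ) (hq : ContinuousOn q (Icc 0 1)) : C(Icc (0:ℝ) 1, ℂ) :=
  ⟨(Icc (0:ℝ) 1).domRestrict q, continuousOn_iff_continuous_domRestrict.1 hq⟩

lemma restrictIcc_apply (q : ℝ → ℂ) (hq : ContinuousOn q (Icc 0 1)) (x : Icc (0:ℝ) 1) :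
    restrictIcc q hq x = q x := rfl

/-- The part of the integrated Dirac system independent of the spectral parameter. -/
def diracPotential (b₁ b₂ : ℝ) (h₁₂ : ContinuousOn Q12 (Icc 0 1))
    (h₂₁ : ContinuousOn Q21 (Icc 0 1)) :
    C(Icc (0:ℝ) 1, ℂ × ℂ) →L[ℂ] C(Icc (0:ℝ) 1, ℂ × ℂ) :=
  volterra (offDiagonal ((-Complex.I * b₁) • restrictIcc Q12 h₁₂)
    ((-Complex.I * b₂) • restrictIcc Q21 h₂₁))

/-- The coefficient of the spectral parameter in the integrated Dirac system. -/
def diracWeight (b₁ b₂ : ℝ) : C(Icc (0:ℝ) 1, ℂ × ℂ) →L[ℂ] C(Icc (0:ℝ) 1, ℂ × ℂ) :=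
  volterra (constDiagonal (Complex.I * b₁) (Complex.I * b₂))

variable (h₁₂ : ContinuousOn Q12 (Icc 0 1)) (h₂₁ : ContinuousOn Q21 (Icc 0 1))

lemma exists_hasDerivAt_of_eq_pencil {z : ℂ} {h u : C(Icc (0:ℝ) 1, ℂ × ℂ)} {w : ℂ × ℂ}
    (hu : u = (diracPotential b₁ b₂ h₁₂ h₂₁ + z • diracWeight b₁ b₂) u +
      (diracWeight b₁ b₂ h + ContinuousMap.const _ w)) :
    ∃ G : ℝ → ℂ × ℂ, Continuous G ∧ (∀ x ∈ Icc (0:ℝ) 1, extendIcc u x = w + ∫ t in (1:ℝ)..x, G t) ∧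
      ∀ x ∈ Icc (0:ℝ) 1, G x =
        (Complex.I * b₁ * (z * (extendIcc u x).1 + (extendIcc h x).1 - Q12 x * (extendIcc u x).2),
          Complex.I * b₂ * (z * (extendIcc u x).2 + (extendIcc h x).2 -
            Q21 x * (extendIcc u x).1)) := by
  set A := offDiagonal ((-Complex.I * b₁) • restrictIcc Q12 h₁₂)
    ((-Complex.I * b₂) • restrictIcc Q21 h₂₁) with hA
  set B := constDiagonal (Complex.I * b₁) (Complex.I * b₂) with hB
  have cA := A.continuous_apply_projIcc u
  have cB := B.continuous_apply_projIcc u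
  have cH := B.continuous_apply_projIcc h
  refine ⟨fun t => (A (projIcc 0 1 zero_le_one t) (u (projIcc 0 1 zero_le_one t)) +
    z • B (projIcc 0 1 zero_le_one t) (u (projIcc 0 1 zero_le_one t))) +
    B (projIcc 0 1 zero_le_one t) (h (projIcc 0 1 zero_le_one t)),
    (cA.add (cB.const_smul z)).add cH, fun x hx => ?_, fun x hx => ?_⟩
  · have := congrArg (fun v : C(Icc (0:ℝ) 1, ℂ × ℂ) => v ⟨x, hx⟩) hu
    rw [extendIcc_of_mem u hx]
    refine this.trans ?_
    beta_reduce
    rw [intervalIntegral.integral_add, intervalIntegral.integral_add,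
      intervalIntegral.integral_smul]
    rotate_left
    · exact cA.intervalIntegrable _ _
    · exact (cB.const_smul z).intervalIntegrable _ _
    · exact (cA.add (cB.const_smul z)).intervalIntegrable _ _
    · exact cH.intervalIntegrable _ _
    simp only [ContinuousMap.add_apply, add_apply, smul_apply, ContinuousMap.smul_apply,
      ContinuousMap.const_apply, diracPotential, diracWeight, volterra_apply, ← hA, ← hB]
    abel
  · simp only [extendIcc_of_mem _ hx, projIcc_of_mem _ hx, hA, hB, offDiagonal_apply,
      constDiagonal_apply]
    ext <;> simp [restrictIcc_apply] <;> ring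

lemma solvesDirac_of_eq_pencil (hb₁ : b₁ ≠ 0) (hb₂ : b₂ ≠ 0) {z : ℂ}
    {h u : C(Icc (0:ℝ) 1, ℂ × ℂ)} {w : ℂ × ℂ}
    (hu : u = (diracPotential b₁ b₂ h₁₂ h₂₁ + z • diracWeight b₁ b₂) u +
      (diracWeight b₁ b₂ h + ContinuousMap.const _ w)) :
    SolvesDirac b₁ b₂ Q12 Q21 (extendIcc u) (fun x => z • extendIcc u x + extendIcc h x) := by
  obtain ⟨G, hG, hInt, hGx⟩ := exists_hasDerivAt_of_eq_pencil h₁₂ h₂₁ hu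
  refine ⟨G, hG.continuousOn.integrableOn_compact isCompact_Icc, fun x hx => ?_, ?_⟩
  · rw [hInt x hx, hInt 0 ⟨le_rfl, zero_le_one⟩, add_assoc,
      intervalIntegral.integral_add_adjacent_intervals (hG.intervalIntegrable _ _)
        (hG.intervalIntegrable _ _)]
  · refine (ae_restrict_iff' (measurableSet_Icc : MeasurableSet I01)).2 (.of_forall fun x hx => ?_)
    have e₁ : (b₁ : ℂ) ≠ 0 := by exact_mod_cast hb₁
    have e₂ : (b₂ : ℂ) ≠ 0 := by exact_mod_cast hb₂
    rw [hGx x hx]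
    constructor
    · simp only [Prod.fst_add, Prod.smul_fst, smul_eq_mul]
      field_simp
      linear_combination (-(z * (extendIcc u x).1 + (extendIcc h x).1 -
        Q12 x * (extendIcc u x).2)) * Complex.I_sq
    · simp only [Prod.snd_add, Prod.smul_snd, smul_eq_mul]
      field_simp
      linear_combination (-(z * (extendIcc u x).2 + (extendIcc h x).2 -
        Q21 x * (extendIcc u x).1)) * Complex.I_sq

lemma apply_one_of_eq_pencil {z : ℂ} {h u : C(Icc (0:ℝ) 1, ℂ × ℂ)} {w : ℂ × ℂ}
    (hu : u = (diracPotential b₁ b₂ h₁₂ h₂₁ + z • diracWeight b₁ b₂) u +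
      (diracWeight b₁ b₂ h + ContinuousMap.const _ w)) : extendIcc u 1 = w := by
  obtain ⟨G, -, hInt, -⟩ := exists_hasDerivAt_of_eq_pencil h₁₂ h₂₁ hu
  simpa using hInt 1 ⟨zero_le_one, le_rfl⟩

lemma approxSolution_of_eq_pencil {z : ℂ}
    {h u : C(Icc (0:ℝ) 1, ℂ × ℂ)} {w : ℂ × ℂ}
    (hu : u = (diracPotential b₁ b₂ h₁₂ h₂₁ + z • diracWeight b₁ b₂) u +
      (diracWeight b₁ b₂ h + ContinuousMap.const _ w)) {H : ℝ} (hH : (|b₁| + |b₂|) * ‖h‖ ≤ H) :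
    ApproxSolution (-b₁) b₂ (fun x => -Complex.I * b₁ * Q12 x) (fun x => -Complex.I * b₂ * Q21 x)
      (-Complex.I * z) H (fun x => (extendIcc u x).1) (fun x => (extendIcc u x).2) := by
  obtain ⟨G, hG, hInt, hGx⟩ := exists_hasDerivAt_of_eq_pencil h₁₂ h₂₁ hu
  have hd : ∀ x ∈ Icc (0:ℝ) 1, HasDerivWithinAt (fun x => extendIcc u x) (G x) (Icc 0 1) x := by
    intro x hx
    have : HasDerivAt (fun x => w + ∫ t in (1:ℝ)..x, G t) (G x) x :=
      (intervalIntegral.integral_hasDerivAt_right (hG.intervalIntegrable _ _)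
        (hG.stronglyMeasurableAtFilter _ _) hG.continuousAt).const_add w
    exact this.hasDerivWithinAt.congr hInt (hInt x hx)
  have hh : ∀ x ∈ Icc (0:ℝ) 1, ‖extendIcc h x‖ ≤ ‖h‖ := fun x hx => by
    rw [extendIcc_of_mem h hx]; exact h.norm_coe_le_norm _
  constructor
  · intro x hx
    refine ⟨Complex.I * b₁ * (extendIcc h x).1, ?_, ?_⟩
    · rw [norm_mul, norm_mul, Complex.norm_I, one_mul, Complex.norm_real, Real.norm_eq_abs]
      have h1 := (norm_fst_le (extendIcc h x)).trans (hh x hx)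
      have h2 := mul_le_mul_of_nonneg_left h1 (abs_nonneg b₁)
      have h3 := mul_nonneg (abs_nonneg b₂) (norm_nonneg h)
      linarith
    · have := (ContinuousLinearMap.fst ℝ ℂ ℂ).hasFDerivAt.comp_hasDerivWithinAt x (hd x hx)
      refine this.congr_deriv ?_
      rw [ContinuousLinearMap.coe_fst', hGx x hx]
      push_cast
      ring
  · intro x hx
    refine ⟨Complex.I * b₂ * (extendIcc h x).2, ?_, ?_⟩
    · rw [norm_mul, norm_mul, Complex.norm_I, one_mul, Complex.norm_real, Real.norm_eq_abs]
      have h1 := (norm_snd_le (extendIcc h x)).trans (hh x hx)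
      have h2 := mul_le_mul_of_nonneg_left h1 (abs_nonneg b₂)
      have h3 := mul_nonneg (abs_nonneg b₁) (norm_nonneg h)
      linarith
    · have := (ContinuousLinearMap.snd ℝ ℂ ℂ).hasFDerivAt.comp_hasDerivWithinAt x (hd x hx)
      refine this.congr_deriv ?_
      rw [ContinuousLinearMap.coe_snd', hGx x hx]
      ring

end Dirac

instance isFiniteMeasure_mu01 : IsFiniteMeasure mu01 :=
  ⟨by simp [mu01, I01]⟩

/-- Constant extension of continuous functions on `[0,1]`, as a bounded operator. -/
def extendIccBounded : C(Icc (0:ℝ) 1, ℂ × ℂ) →L[ℂ] BoundedContinuousFunction ℝ (ℂ × ℂ) :=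
  LinearMap.mkContinuous
    { toFun := fun u => (BoundedContinuousFunction.mkOfCompact u).compContinuous
        ⟨projIcc 0 1 zero_le_one, continuous_projIcc⟩
      map_add' := fun _ _ => rfl
      map_smul' := fun _ _ => rfl } 1 fun u => by
    rw [one_mul]
    exact (BoundedContinuousFunction.norm_le (norm_nonneg u)).2 fun x => u.norm_coe_le_norm _

lemma coe_extendIccBounded (u : C(Icc (0:ℝ) 1, ℂ × ℂ)) :
    (extendIccBounded u : ℝ → ℂ × ℂ) = extendIcc u := rfl

/-- The embedding of the continuous functions on `[0,1]` into `L²`. -/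
def toLpIcc : C(Icc (0:ℝ) 1, ℂ × ℂ) →L[ℂ] Lp (ℂ × ℂ) 2 mu01 :=
  (BoundedContinuousFunction.toLp 2 mu01 ℂ).comp extendIccBounded

lemma coeFn_toLpIcc (u : C(Icc (0:ℝ) 1, ℂ × ℂ)) : toLpIcc u =ᵐ[mu01] extendIcc u := by
  have := BoundedContinuousFunction.coeFn_toLp (𝕜 := ℂ) 2 mu01 (extendIccBounded u)
  rwa [coe_extendIccBounded] at this

/-- The first boundary form. -/
def boundaryForm (α₁ α₂ α₃ : ℂ) : C(Icc (0:ℝ) 1, ℂ × ℂ) →L[ℂ] ℂ :=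
  (α₁ • ContinuousLinearMap.fst ℂ ℂ ℂ + α₂ • ContinuousLinearMap.snd ℂ ℂ ℂ).comp
      (ContinuousMap.evalCLM ℂ ⟨0, le_rfl, zero_le_one⟩) +
    (α₃ • ContinuousLinearMap.fst ℂ ℂ ℂ).comp (ContinuousMap.evalCLM ℂ ⟨1, zero_le_one, le_rfl⟩)

lemma boundaryForm_apply (α₁ α₂ α₃ : ℂ) (u : C(Icc (0:ℝ) 1, ℂ × ℂ)) :
    boundaryForm α₁ α₂ α₃ u =
      α₁ * (extendIcc u 0).1 + α₂ * (extendIcc u 0).2 + α₃ * (extendIcc u 1).1 := by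
  rw [extendIcc_of_mem u ⟨le_rfl, zero_le_one⟩, extendIcc_of_mem u ⟨zero_le_one, le_rfl⟩]
  simp [boundaryForm]

lemma satisfiesBC_iff {α₁ α₂ α₃ : ℂ} {y : ℝ → ℂ × ℂ} :
    SatisfiesBC ![![α₁, α₂, α₃, 0], ![0, 0, 0, 1]] y ↔
      α₁ * (y 0).1 + α₂ * (y 0).2 + α₃ * (y 1).1 = 0 ∧ (y 1).2 = 0 := by
  simp [SatisfiesBC, Fin.forall_fin_two]

theorem functional_toLpIcc_eq_zero {b₁ b₂ : ℝ} (hb₁ : b₁ < 0) (hb₂ : 0 < b₂) {Q12 Q21 : ℝ → ℂ}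
    (hQ12 : AnalyticOnNhd ℝ Q12 (Icc 0 1)) (hQ21 : AnalyticOnNhd ℝ Q21 (Icc 0 1))
    (hne : ¬ ∀ x ∈ Icc (0:ℝ) 1, Q21 x = 0) {α₁ α₂ α₃ : ℂ} (hα₂ : α₂ ≠ 0)
    (ℓ : Lp (ℂ × ℂ) 2 mu01 →L[ℂ] ℂ)
    (hℓ : ∀ g : Lp (ℂ × ℂ) 2 mu01, (∃ y : ℝ → ℂ × ℂ,
      IsRootFunction b₁ b₂ Q12 Q21 ![![α₁, α₂, α₃, 0], ![0, 0, 0, 1]] y ∧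
        (g : ℝ → ℂ × ℂ) =ᵐ[mu01] y) → ℓ g = 0)
    (h : ℕ → C(Icc (0:ℝ) 1, ℂ × ℂ))
    (hh : ∀ n, diracWeight b₁ b₂ (h (n + 1)) =
      h n - diracPotential b₁ b₂ hQ12.continuousOn hQ21.continuousOn (h n))
    (hU : ∀ n, boundaryForm α₁ α₂ α₃ (h n) = 0) :
    ℓ (toLpIcc (h 0)) = 0 := by
  have e₂ : -Complex.I * (b₂:ℂ) ≠ 0 := by simp [hb₂.ne']
  obtain ⟨C, ρ, N, hC, hray⟩ := exists_norm_le_of_diagonal (neg_pos.2 hb₁) hb₂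
    (q₁ := fun x => -Complex.I * b₁ * Q12 x) (q₂ := fun x => -Complex.I * b₂ * Q21 x)
    (fun x hx => analyticAt_const.mul (hQ12 x hx)) (fun x hx => analyticAt_const.mul (hQ21 x hx))
    (fun h0 => hne fun x hx => (mul_eq_zero.1 (h0 x hx)).resolve_left e₂)
    (α₁ := α₁) (α₃ := α₃) hα₂
  have hone : ∀ u : C(Icc (0:ℝ) 1, ℂ × ℂ), ∀ z : ℂ, u + ContinuousMap.const _ (z, (0:ℂ)) =
      u + z • ContinuousMap.const _ ((1:ℂ), (0:ℂ)) := fun u z => by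
    congr 1; ext x <;> simp
  refine functional_eq_zero_of_chains_of_ray_bound
    (E := C(Icc (0:ℝ) 1, ℂ × ℂ))
    (V₀ := diracPotential b₁ b₂ hQ12.continuousOn hQ21.continuousOn) (V₁ := diracWeight b₁ b₂)
    (add_nonneg (norm_nonneg (offDiagonal ((-Complex.I * b₁) • restrictIcc Q12 hQ12.continuousOn)
      ((-Complex.I * b₂) • restrictIcc Q21 hQ21.continuousOn)))
      (norm_nonneg (constDiagonal (Complex.I * b₁) (Complex.I * b₂))))
    (norm_volterra_pencil_pow_le _ _) (boundaryForm α₁ α₂ α₃) (ℓ.comp toLpIcc)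
    (e := ContinuousMap.const _ ((1:ℂ), (0:ℂ))) ?_ ?_ (C := C * (|b₁| + |b₂|)) (ρ := ρ) (N := N)
    ?_ h hh hU
  · intro h0
    have := congrArg (fun u : C(Icc (0:ℝ) 1, ℂ × ℂ) => (u ⟨0, le_rfl, zero_le_one⟩).1) h0
    simp at this
  · intro z ch h0 hs m hm
    have h0' : ch 0 = (diracPotential b₁ b₂ hQ12.continuousOn hQ21.continuousOn +
        z • diracWeight b₁ b₂) (ch 0) +
        (diracWeight b₁ b₂ 0 + ContinuousMap.const _ ((1:ℂ), (0:ℂ))) := by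
      rw [map_zero, zero_add]; exact h0
    have hs' : ∀ j, ch (j + 1) = (diracPotential b₁ b₂ hQ12.continuousOn hQ21.continuousOn +
        z • diracWeight b₁ b₂) (ch (j + 1)) +
        (diracWeight b₁ b₂ (ch j) + ContinuousMap.const _ (0 : ℂ × ℂ)) := fun j => by
      have : (ContinuousMap.const (Icc (0:ℝ) 1) (0 : ℂ × ℂ)) = 0 := rfl
      rw [this, add_zero]; exact hs j
    refine hℓ _ ⟨extendIcc (ch m), ⟨z, m, fun j => extendIcc (ch j), fun j hj => ?_,
      ⟨1, ⟨zero_le_one, le_rfl⟩, ?_⟩, ?_, fun j hj _ => ?_, m, le_rfl, rfl⟩, coeFn_toLpIcc _⟩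
    · rw [satisfiesBC_iff]
      refine ⟨by rw [← boundaryForm_apply]; exact hm j hj, ?_⟩
      cases j with
      | zero => beta_reduce; rw [apply_one_of_eq_pencil _ _ h0']
      | succ j => beta_reduce; rw [apply_one_of_eq_pencil _ _ (hs' j)]; rfl
    · beta_reduce; rw [apply_one_of_eq_pencil _ _ h0']; simp
    · have := solvesDirac_of_eq_pencil _ _ hb₁.ne hb₂.ne' h0'
      have h00 : ∀ x, extendIcc (0 : C(Icc (0:ℝ) 1, ℂ × ℂ)) x = 0 := fun _ => rfl
      simpa [h00] using this
    · obtain ⟨j, rfl⟩ : ∃ i, j = i + 1 := ⟨j - 1, by omega⟩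
      exact solvesDirac_of_eq_pencil _ _ hb₁.ne hb₂.ne' (hs' j)
  · intro z hz hd c f u hu hb
    have hu' := hu
    rw [← hone] at hu'
    have h1 := apply_one_of_eq_pencil _ _ hu'
    have hz' : ‖-Complex.I * z‖ = ‖z‖ := by simp
    set P := C * (1 + ‖z‖) ^ N with hP
    have hP0 : 0 < P := by positivity
    have hbb : 0 < |b₁| + |b₂| := add_pos (abs_pos.2 hb₁.ne) (abs_pos.2 hb₂.ne')
    refine le_of_forall_pos_le_add fun ε hε => ?_
    have key := hray (-Complex.I * z) ((|b₁| + |b₂|) * ‖f‖ + ε / P) _ _ (by rwa [hz'])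
      (by simp [hd]) (by positivity)
      (approxSolution_of_eq_pencil _ _ hu' (by linarith [div_pos hε hP0]))
      (by rw [h1]) (by rw [← boundaryForm_apply]; exact hb)
    rw [hz', ← hP] at key
    have hr : P * ((|b₁| + |b₂|) * ‖f‖ + ε / P) = C * (|b₁| + |b₂|) * (1 + ‖z‖) ^ N * ‖f‖ + ε := by
      rw [mul_add, mul_div_cancel₀ _ hP0.ne', hP]; ring
    rw [hr] at key
    refine (ContinuousMap.norm_le _ (by positivity)).2 fun x => ?_
    have := key x x.2
    rw [extendIcc_of_mem u x.2] at this
    rw [Prod.norm_def]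
    exact max_le this.1 this.2

/-- The Dirac differential expression. -/
def diracExpr (b₁ b₂ : ℝ) (Q12 Q21 : ℝ → ℂ) (φ : ℝ → ℂ × ℂ) (x : ℝ) : ℂ × ℂ :=
  (-Complex.I * (b₁:ℂ)⁻¹ * (deriv φ x).1 + Q12 x * (φ x).2,
    -Complex.I * (b₂:ℂ)⁻¹ * (deriv φ x).2 + Q21 x * (φ x).1)

section

variable {b₁ b₂ : ℝ} {Q12 Q21 : ℝ → ℂ} {φ : ℝ → ℂ × ℂ} {K : Set ℝ}

lemma diracExpr_eq_zero (hK : IsClosed K) (hφ : ∀ x ∉ K, φ x = 0) :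
    ∀ x ∉ K, diracExpr b₁ b₂ Q12 Q21 φ x = 0 := by
  intro x hx
  have h1 : φ =ᶠ[nhds x] fun _ => 0 := by
    filter_upwards [hK.isOpen_compl.mem_nhds hx] with y hy using hφ y hy
  have h2 : deriv φ x = 0 := by rw [h1.deriv_eq]; simp
  simp [diracExpr, h2, hφ x hx]

lemma contDiff_diracExpr (hQ12 : AnalyticOnNhd ℝ Q12 (Icc 0 1))
    (hQ21 : AnalyticOnNhd ℝ Q21 (Icc 0 1)) (hK : IsClosed K) (hK01 : K ⊆ Icc 0 1)
    (hc : ContDiff ℝ (⊤ : ℕ∞) φ) (hφ : ∀ x ∉ K, φ x = 0) :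
    ContDiff ℝ (⊤ : ℕ∞) (diracExpr b₁ b₂ Q12 Q21 φ) := by
  rw [contDiff_iff_contDiffAt]
  intro x
  by_cases hx : x ∈ K
  · have h1 : ContDiffAt ℝ (⊤ : ℕ∞) Q12 x := (hQ12 x (hK01 hx)).contDiffAt
    have h2 : ContDiffAt ℝ (⊤ : ℕ∞) Q21 x := (hQ21 x (hK01 hx)).contDiffAt
    have h3 : ContDiffAt ℝ (⊤ : ℕ∞) (deriv φ) x := ((contDiff_infty_iff_deriv.1 hc).2).contDiffAt
    have h4 : ContDiffAt ℝ (⊤ : ℕ∞) φ x := hc.contDiffAt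
    exact ((contDiffAt_const.mul h3.fst).add (h1.mul h4.snd)).prodMk
      ((contDiffAt_const.mul h3.snd).add (h2.mul h4.fst))
  · refine (contDiffAt_const (c := (0 : ℂ × ℂ))).congr_of_eventuallyEq ?_
    filter_upwards [hK.isOpen_compl.mem_nhds hx] with y hy
    exact diracExpr_eq_zero hK hφ y hy

lemma iterate_diracExpr (hQ12 : AnalyticOnNhd ℝ Q12 (Icc 0 1))
    (hQ21 : AnalyticOnNhd ℝ Q21 (Icc 0 1)) (hK : IsClosed K) (hK01 : K ⊆ Icc 0 1)
    (hc : ContDiff ℝ (⊤ : ℕ∞) φ) (hφ : ∀ x ∉ K, φ x = 0) (n : ℕ) :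
    ContDiff ℝ (⊤ : ℕ∞) ((diracExpr b₁ b₂ Q12 Q21)^[n] φ) ∧
      ∀ x ∉ K, ((diracExpr b₁ b₂ Q12 Q21)^[n] φ) x = 0 := by
  induction n with
  | zero => exact ⟨hc, hφ⟩
  | succ n ih =>
    rw [Function.iterate_succ_apply']
    exact ⟨contDiff_diracExpr hQ12 hQ21 hK hK01 ih.1 ih.2, diracExpr_eq_zero hK ih.2⟩

lemma diracWeight_diracExpr (hb₁ : b₁ ≠ 0) (hb₂ : b₂ ≠ 0)
    (h₁₂ : ContinuousOn Q12 (Icc 0 1)) (h₂₁ : ContinuousOn Q21 (Icc 0 1))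
    (hc : ContDiff ℝ (⊤ : ℕ∞) φ) (h1 : φ 1 = 0) (u v : C(Icc (0:ℝ) 1, ℂ × ℂ))
    (hu : ∀ x, u x = φ x) (hv : ∀ x, v x = diracExpr b₁ b₂ Q12 Q21 φ x) :
    diracWeight b₁ b₂ v = u - diracPotential b₁ b₂ h₁₂ h₂₁ u := by
  have e₁ : (b₁ : ℂ) ≠ 0 := by exact_mod_cast hb₁
  have e₂ : (b₂ : ℂ) ≠ 0 := by exact_mod_cast hb₂
  rw [eq_sub_iff_add_eq]
  ext1 x
  rw [ContinuousMap.add_apply, diracWeight, diracPotential, volterra_apply, volterra_apply,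
    ← intervalIntegral.integral_add ((ContinuousMap.continuous_apply_projIcc _ _).intervalIntegrable
      _ _) ((ContinuousMap.continuous_apply_projIcc _ _).intervalIntegrable _ _)]
  have hd : ∫ t in (1:ℝ)..x, deriv φ t = φ x - φ 1 :=
    intervalIntegral.integral_deriv_eq_sub (fun t _ => hc.differentiable (by simp) t)
      ((hc.continuous_deriv (by simp)).intervalIntegrable _ _)
  rw [hu, ← sub_zero (φ x), ← h1, ← hd]
  refine intervalIntegral.integral_congr fun t ht => ?_
  have ht' : t ∈ Icc (0:ℝ) 1 := by
    rw [uIcc_of_ge x.2.2] at ht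
    exact ⟨x.2.1.trans ht.1, ht.2⟩
  simp only [projIcc_of_mem _ ht', constDiagonal_apply, offDiagonal_apply, hu, hv, diracExpr,
    ContinuousMap.smul_apply, restrictIcc_apply, smul_eq_mul]
  ext1
  · simp only [Prod.fst_add]
    field_simp
    linear_combination (-(deriv φ t).1) * Complex.I_sq
  · simp only [Prod.snd_add]
    field_simp
    linear_combination (-(deriv φ t).2) * Complex.I_sq

end

lemma functional_toLpIcc_test_eq_zero {b₁ b₂ : ℝ} (hb₁ : b₁ < 0) (hb₂ : 0 < b₂) {Q12 Q21 : ℝ → ℂ}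
    (hQ12 : AnalyticOnNhd ℝ Q12 (Icc 0 1)) (hQ21 : AnalyticOnNhd ℝ Q21 (Icc 0 1))
    (hne : ¬ ∀ x ∈ Icc (0:ℝ) 1, Q21 x = 0) {α₁ α₂ α₃ : ℂ} (hα₂ : α₂ ≠ 0)
    (ℓ : Lp (ℂ × ℂ) 2 mu01 →L[ℂ] ℂ)
    (hℓ : ∀ g : Lp (ℂ × ℂ) 2 mu01, (∃ y : ℝ → ℂ × ℂ,
      IsRootFunction b₁ b₂ Q12 Q21 ![![α₁, α₂, α₃, 0], ![0, 0, 0, 1]] y ∧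
        (g : ℝ → ℂ × ℂ) =ᵐ[mu01] y) → ℓ g = 0)
    {φ : ℝ → ℂ × ℂ} {K : Set ℝ} (hK : IsClosed K) (hK01 : K ⊆ Ioo 0 1)
    (hc : ContDiff ℝ (⊤ : ℕ∞) φ) (hφ : ∀ x ∉ K, φ x = 0) {g : Lp (ℂ × ℂ) 2 mu01}
    (hg : (g : ℝ → ℂ × ℂ) =ᵐ[mu01] φ) :
    ℓ g = 0 := by
  have hit := iterate_diracExpr (b₁ := b₁) (b₂ := b₂) hQ12 hQ21 hK
    (hK01.trans Ioo_subset_Icc_self) hc hφ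
  let h : ℕ → C(Icc (0:ℝ) 1, ℂ × ℂ) := fun n =>
    ⟨fun x => (diracExpr b₁ b₂ Q12 Q21)^[n] φ x, (hit n).1.continuous.comp continuous_subtype_val⟩
  have h0 : (0:ℝ) ∉ K := fun h => lt_irrefl _ (hK01 h).1
  have h1 : (1:ℝ) ∉ K := fun h => lt_irrefl _ (hK01 h).2
  have key := functional_toLpIcc_eq_zero hb₁ hb₂ hQ12 hQ21 hne (α₁ := α₁) (α₃ := α₃) hα₂ ℓ hℓ h
    (fun n => diracWeight_diracExpr hb₁.ne hb₂.ne' _ _ (hit n).1 ((hit n).2 1 h1) _ _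
      (fun _ => rfl) fun x => by
        rw [← Function.iterate_succ_apply' (diracExpr b₁ b₂ Q12 Q21)]; rfl)
    (fun n => by
      rw [boundaryForm_apply, extendIcc_of_mem _ ⟨le_rfl, zero_le_one⟩,
        extendIcc_of_mem _ ⟨zero_le_one, le_rfl⟩]
      simp [h, (hit n).2 0 h0, (hit n).2 1 h1])
  have : toLpIcc (h 0) = g := by
    refine Lp.ext ((coeFn_toLpIcc _).trans (EventuallyEq.trans ?_ hg.symm))
    refine (ae_restrict_iff' (measurableSet_Icc : MeasurableSet I01)).2 (.of_forall fun x hx => ?_)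
    rw [extendIcc_of_mem _ hx]; rfl
  rwa [this] at key

lemma ae_mem_Ioo_mu01 : ∀ᵐ x ∂mu01, x ∈ Ioo (0:ℝ) 1 := by
  have : mu01 = volume.restrict (Ioo (0:ℝ) 1) :=
    (Measure.restrict_congr_set Ioo_ae_eq_Icc).symm
  rw [this]
  exact ae_restrict_mem measurableSet_Ioo

lemma functional_eq_zero_of_test (ℓ : Lp ℂ 2 mu01 →L[ℂ] ℂ)
    (hℓ : ∀ ψ : ℝ → ℝ, ContDiff ℝ (⊤ : ℕ∞) ψ → HasCompactSupport ψ → tsupport ψ ⊆ Ioo 0 1 →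
      ∀ g : Lp ℂ 2 mu01, g =ᵐ[mu01] (fun x => (ψ x : ℂ)) → ℓ g = 0) : ℓ = 0 := by
  set f := (InnerProductSpace.toDual ℂ (Lp ℂ 2 mu01)).symm ℓ with hf
  have hfl : ∀ g, ℓ g = inner ℂ f g := fun g => by
    rw [hf, InnerProductSpace.toDual_symm_apply]
  have hInt : Integrable (fun x => starRingEnd ℂ (f x)) mu01 :=
    (Lp.memLp f).star.integrable one_le_two
  have hz : ∀ᵐ x ∂mu01, x ∈ Ioo (0:ℝ) 1 → starRingEnd ℂ (f x) = 0 := by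
    refine isOpen_Ioo.ae_eq_zero_of_integral_contDiff_smul_eq_zero
      (hInt.locallyIntegrable.locallyIntegrableOn _) fun ψ hψ hs ht => ?_
    have hm : MemLp (fun x => (ψ x : ℂ)) 2 mu01 :=
      (Complex.continuous_ofReal.comp hψ.continuous).memLp_of_hasCompactSupport
        (hs.comp_left (g := fun r : ℝ => (r : ℂ)) (by simp))
    have h1 := hℓ ψ hψ hs ht (hm.toLp _) hm.coeFn_toLp
    rw [hfl, L2.inner_def] at h1
    rw [← h1]
    refine integral_congr_ae ?_
    filter_upwards [hm.coeFn_toLp] with x hx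
    rw [hx, RCLike.inner_apply, Complex.real_smul]
  have hf0 : f = 0 := by
    refine Lp.ext ?_
    filter_upwards [hz, ae_mem_Ioo_mu01, Lp.coeFn_zero ℂ 2 mu01] with x h1 h2 h3
    rw [h3]
    simpa using h1 h2
  ext g
  rw [hfl, hf0, inner_zero_left]; rfl

lemma functional_prod_eq_zero_of_test (ℓ : Lp (ℂ × ℂ) 2 mu01 →L[ℂ] ℂ)
    (hℓ : ∀ (φ : ℝ → ℂ × ℂ) (K : Set ℝ), IsClosed K → K ⊆ Ioo 0 1 → ContDiff ℝ (⊤ : ℕ∞) φ →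
      (∀ x ∉ K, φ x = 0) → ∀ g : Lp (ℂ × ℂ) 2 mu01, g =ᵐ[mu01] φ → ℓ g = 0) : ℓ = 0 := by
  have key : ∀ T : ℂ →L[ℂ] ℂ × ℂ, ℓ.comp (T.compLpL 2 mu01) = 0 := fun T => by
    refine functional_eq_zero_of_test _ fun ψ hψ hs ht g hg => ?_
    refine hℓ (fun x => T (ψ x)) (tsupport ψ) (isClosed_tsupport ψ) ht ?_ (fun x hx => ?_) _ ?_
    · exact (T.restrictScalars ℝ).contDiff.comp (Complex.ofRealCLM.contDiff.comp hψ)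
    · rw [image_eq_zero_of_notMem_tsupport hx]; simp
    · filter_upwards [T.coeFn_compLpL g, hg] with x h1 h2
      exact h1.trans (by rw [h2])
  ext v
  have hv : v = (ContinuousLinearMap.inl ℂ ℂ ℂ).compLpL 2 mu01
      ((ContinuousLinearMap.fst ℂ ℂ ℂ).compLpL 2 mu01 v) +
      (ContinuousLinearMap.inr ℂ ℂ ℂ).compLpL 2 mu01
      ((ContinuousLinearMap.snd ℂ ℂ ℂ).compLpL 2 mu01 v) := by
    refine Lp.ext ?_
    filter_upwards [Lp.coeFn_add ((ContinuousLinearMap.inl ℂ ℂ ℂ).compLpL 2 mu01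
      ((ContinuousLinearMap.fst ℂ ℂ ℂ).compLpL 2 mu01 v))
      ((ContinuousLinearMap.inr ℂ ℂ ℂ).compLpL 2 mu01
      ((ContinuousLinearMap.snd ℂ ℂ ℂ).compLpL 2 mu01 v)),
      (ContinuousLinearMap.inl ℂ ℂ ℂ).coeFn_compLpL (p := 2) (μ := mu01)
        ((ContinuousLinearMap.fst ℂ ℂ ℂ).compLpL 2 mu01 v),
      (ContinuousLinearMap.inr ℂ ℂ ℂ).coeFn_compLpL (p := 2) (μ := mu01)
        ((ContinuousLinearMap.snd ℂ ℂ ℂ).compLpL 2 mu01 v),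
      (ContinuousLinearMap.fst ℂ ℂ ℂ).coeFn_compLpL v,
      (ContinuousLinearMap.snd ℂ ℂ ℂ).coeFn_compLpL v] with x h1 h2 h3 h4 h5
    rw [h1, Pi.add_apply, h2, h3, h4, h5]
    simp
  have e1 := congrArg (fun T : Lp ℂ 2 mu01 →L[ℂ] ℂ =>
    T ((ContinuousLinearMap.fst ℂ ℂ ℂ).compLpL 2 mu01 v)) (key (ContinuousLinearMap.inl ℂ ℂ ℂ))
  have e2 := congrArg (fun T : Lp ℂ 2 mu01 →L[ℂ] ℂ =>
    T ((ContinuousLinearMap.snd ℂ ℂ ℂ).compLpL 2 mu01 v)) (key (ContinuousLinearMap.inr ℂ ℂ ℂ))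
  rw [hv, map_add]
  exact (congrArg₂ (· + ·) e1 e2).trans (add_zero 0)

theorem rootSystemComplete_of_ne_zero {b₁ b₂ : ℝ} (hb₁ : b₁ < 0) (hb₂ : 0 < b₂) {Q12 Q21 : ℝ → ℂ}
    (hQ12 : AnalyticOnNhd ℝ Q12 (Icc 0 1)) (hQ21 : AnalyticOnNhd ℝ Q21 (Icc 0 1))
    (hne : ¬ ∀ x ∈ Icc (0:ℝ) 1, Q21 x = 0) {α₁ α₂ α₃ : ℂ} (hα₂ : α₂ ≠ 0) :
    RootSystemComplete b₁ b₂ Q12 Q21 ![![α₁, α₂, α₃, 0], ![0, 0, 0, 1]] := by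
  rw [RootSystemComplete, eq_top_iff]
  set S := Submodule.span ℂ {g : Lp (ℂ × ℂ) 2 mu01 |
    ∃ y, IsRootFunction b₁ b₂ Q12 Q21 ![![α₁, α₂, α₃, 0], ![0, 0, 0, 1]] y ∧ g =ᵐ[mu01] y} with hS
  have hcl : IsClosed (S.topologicalClosure : Set (Lp (ℂ × ℂ) 2 mu01)) :=
    S.isClosed_topologicalClosure
  intro v _
  by_contra hv
  have hq : S.topologicalClosure.mkQ v ≠ 0 := fun h =>
    hv ((Submodule.Quotient.mk_eq_zero _).1 h)
  obtain ⟨F, hF⟩ := SeparatingDual.exists_ne_zero (R := ℂ) hq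
  have hmem : ∀ g ∈ S, S.topologicalClosure.mkQ g = 0 := fun g hg =>
    (Submodule.Quotient.mk_eq_zero _).2 (S.le_topologicalClosure hg)
  have h0 : F.comp S.topologicalClosure.mkQL = 0 := by
    refine functional_prod_eq_zero_of_test _ fun φ K hK hK01 hc hφ g hg =>
      functional_toLpIcc_test_eq_zero (α₁ := α₁) (α₃ := α₃) hb₁ hb₂ hQ12 hQ21 hne hα₂ _ (fun g hg => ?_) hK hK01 hc hφ hg
    exact (congrArg F (hmem g (Submodule.subset_span hg))).trans (map_zero F)
  exact hF (congrArg (fun T : Lp (ℂ × ℂ) 2 mu01 →L[ℂ] ℂ => T v) h0)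

lemma eq_zero_of_primitive_of_ae_eq_mul {u g : ℝ → ℂ} {c : ℂ} (hg : IntegrableOn g (Icc 0 1))
    (hu : ∀ x ∈ Icc (0:ℝ) 1, u x = u 0 + ∫ t in (0:ℝ)..x, g t)
    (hae : ∀ᵐ x ∂mu01, g x = c * u x) (h1 : u 1 = 0) : ∀ x ∈ Icc (0:ℝ) 1, u x = 0 := by
  have huc : ContinuousOn u (Icc 0 1) := by
    have := intervalIntegral.continuousOn_primitive_interval (μ := volume) (a := 0) (b := 1)
      (f := g) (by rwa [uIcc_of_le zero_le_one])
    rw [uIcc_of_le zero_le_one] at this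
    exact (continuousOn_const.add this).congr hu
  set v := IccExtend zero_le_one ((Icc (0:ℝ) 1).domRestrict u) with hv
  have hvc : Continuous v := huc.domRestrict.Icc_extend'
  have hvu : ∀ x ∈ Icc (0:ℝ) 1, v x = u x := fun x hx => by
    rw [hv, IccExtend_of_mem _ _ hx]; rfl
  have hU : ∀ x ∈ Icc (0:ℝ) 1, u 0 + ∫ t in (0:ℝ)..x, c * v t = v x := fun x hx => by
    rw [hvu x hx, hu x hx]
    congr 1
    refine intervalIntegral.integral_congr_ae_restrict ?_
    have hsub : uIoc 0 x ⊆ Icc (0:ℝ) 1 := by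
      rw [uIoc_of_le hx.1]
      exact fun t ht => ⟨ht.1.le, ht.2.trans hx.2⟩
    filter_upwards [ae_restrict_of_ae_restrict_of_subset hsub hae,
      ae_restrict_mem measurableSet_uIoc] with t ht hm
    rw [ht, hvu t (hsub hm)]
  have hd : ∀ x, HasDerivAt (fun x => u 0 + ∫ t in (0:ℝ)..x, c * v t) (c * v x) x := fun x =>
    (intervalIntegral.integral_hasDerivAt_right ((continuous_const.mul hvc).intervalIntegrable _ _)
      ((continuous_const.mul hvc).stronglyMeasurableAtFilter _ _)
      (continuous_const.mul hvc).continuousAt).const_add _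
  have he : ∀ x : ℝ, HasDerivAt (fun x : ℝ => Complex.exp (-c * x)) (Complex.exp (-c * x) * -c) x :=
    fun x => by
      simpa using ((Complex.ofRealCLM.hasDerivAt (x := x)).const_mul (-c)).cexp
  have hF := fun x => (he x).mul (hd x)
  have hconst := constant_of_has_deriv_right_zero (a := 0) (b := 1)
    (fun x _ => (hF x).continuousAt.continuousWithinAt) fun x hx => by
      convert (hF x).hasDerivWithinAt using 1
      rw [hU x ⟨hx.1, hx.2.le⟩]
      ring
  have hF1 := hconst 1 (right_mem_Icc.2 zero_le_one)
  intro x hx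
  have hFx := (hconst x hx).trans hF1.symm
  simp only [Pi.mul_apply] at hFx
  rw [hU x hx, hU 1 (right_mem_Icc.2 zero_le_one), hvu x hx,
    hvu 1 (right_mem_Icc.2 zero_le_one), h1, mul_zero] at hFx
  exact (mul_eq_zero.1 hFx).resolve_left (Complex.exp_ne_zero _)

lemma SolvesDirac.snd_eq_zero {b₁ b₂ : ℝ} (hb₂ : b₂ ≠ 0) {Q12 Q21 : ℝ → ℂ}
    (hQ : ∀ x ∈ Icc (0:ℝ) 1, Q21 x = 0) {y rhs : ℝ → ℂ × ℂ} {lam : ℂ}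
    (hy : SolvesDirac b₁ b₂ Q12 Q21 y rhs)
    (hr : ∀ x ∈ Icc (0:ℝ) 1, (rhs x).2 = lam * (y x).2) (h1 : (y 1).2 = 0) :
    ∀ x ∈ Icc (0:ℝ) 1, (y x).2 = 0 := by
  obtain ⟨g, hg, hyg, hae⟩ := hy
  refine eq_zero_of_primitive_of_ae_eq_mul (u := fun x => (y x).2) (g := fun x => (g x).2)
    (c := Complex.I * b₂ * lam) hg.snd (fun x hx => ?_) ?_ h1
  · have hgi : IntervalIntegrable g volume 0 x :=
      (intervalIntegrable_iff_integrableOn_Ioc_of_le hx.1).2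
        (hg.mono_set fun t ht => ⟨ht.1.le, ht.2.trans hx.2⟩)
    have := (ContinuousLinearMap.snd ℂ ℂ ℂ).intervalIntegral_comp_comm hgi
    simp only [ContinuousLinearMap.coe_snd'] at this
    rw [this]
    exact congrArg Prod.snd (hyg x hx)
  · filter_upwards [hae, ae_restrict_mem measurableSet_Icc] with x hx hm
    have h2 := hx.2
    rw [hQ x hm, hr x hm] at h2
    have hb : (b₂ : ℂ) ≠ 0 := Complex.ofReal_ne_zero.2 hb₂
    have h3 : (g x).2 = Complex.I * b₂ * (-Complex.I * (b₂ : ℂ)⁻¹ * (g x).2) := by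
      field_simp
      rw [Complex.I_sq]; ring
    rw [h3, eq_sub_of_add_eq h2]
    ring

lemma IsRootFunction.snd_eq_zero {b₁ b₂ : ℝ} (hb₂ : b₂ ≠ 0) {Q12 Q21 : ℝ → ℂ}
    (hQ : ∀ x ∈ Icc (0:ℝ) 1, Q21 x = 0) {α₁ α₂ α₃ : ℂ} {y : ℝ → ℂ × ℂ}
    (hy : IsRootFunction b₁ b₂ Q12 Q21 ![![α₁, α₂, α₃, 0], ![0, 0, 0, 1]] y) :
    ∀ x ∈ Icc (0:ℝ) 1, (y x).2 = 0 := by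
  obtain ⟨lam, m, ch, hbc, -, h0, hs, j, hj, rfl⟩ := hy
  have hone : ∀ j ≤ m, (ch j 1).2 = 0 := fun j hj => (satisfiesBC_iff.1 (hbc j hj)).2
  induction j with
  | zero => exact h0.snd_eq_zero hb₂ hQ (lam := lam) (fun x _ => rfl) (hone 0 hj)
  | succ k ih =>
    refine (hs (k + 1) (by omega) hj).snd_eq_zero hb₂ hQ (lam := lam) (fun x hx => ?_)
      (hone _ hj)
    simp [ih (by omega) x hx]

theorem not_rootSystemComplete_of_eq_zero {b₁ b₂ : ℝ} (hb₂ : b₂ ≠ 0) {Q12 Q21 : ℝ → ℂ}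
    (hQ : ∀ x ∈ Icc (0:ℝ) 1, Q21 x = 0) {α₁ α₂ α₃ : ℂ} :
    ¬ RootSystemComplete b₁ b₂ Q12 Q21 ![![α₁, α₂, α₃, 0], ![0, 0, 0, 1]] := by
  intro h
  set T := (ContinuousLinearMap.snd ℂ ℂ ℂ).compLpL 2 mu01 with hT
  have hle := Submodule.topologicalClosure_minimal (Submodule.span ℂ {g : Lp (ℂ × ℂ) 2 mu01 |
      ∃ y, IsRootFunction b₁ b₂ Q12 Q21 ![![α₁, α₂, α₃, 0], ![0, 0, 0, 1]] y ∧ g =ᵐ[mu01] y})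
    (t := T.ker) (Submodule.span_le.2 ?_) T.isClosed_ker
  · have hmem : toLpIcc (ContinuousMap.const _ ((0 : ℂ), (1 : ℂ))) ∈ T.ker :=
      hle (by rw [RootSystemComplete] at h; rw [h]; trivial)
    have h0 : T (toLpIcc (ContinuousMap.const _ ((0 : ℂ), (1 : ℂ)))) = 0 := hmem
    have hae : ∀ᵐ x ∂mu01, False := by
      filter_upwards [(ContinuousLinearMap.snd ℂ ℂ ℂ).coeFn_compLpL (μ := mu01)
        (toLpIcc (ContinuousMap.const _ ((0 : ℂ), (1 : ℂ)))),
        coeFn_toLpIcc (ContinuousMap.const _ ((0 : ℂ), (1 : ℂ))),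
        Lp.coeFn_zero ℂ 2 mu01, ae_mem_Ioo_mu01] with x e1 e2 e3 e4
      rw [← hT, h0, e3, e2, extendIcc_of_mem _ (Ioo_subset_Icc_self e4)] at e1
      simp at e1
    have hz : mu01 = 0 := by simpa using hae
    have : mu01 univ = 1 := by simp [mu01, I01]
    simp [hz] at this
  · rintro g ⟨y, hy, hg⟩
    change T g = 0
    refine Lp.ext ?_
    filter_upwards [(ContinuousLinearMap.snd ℂ ℂ ℂ).coeFn_compLpL g, hg, Lp.coeFn_zero ℂ 2 mu01,
      ae_restrict_mem measurableSet_Icc] with x e1 e2 e3 e4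
    rw [e1, e2, e3]
    exact hy.snd_eq_zero hb₂ hQ x e4

/-- Corollary: completeness criterion for analytic potentials and the
degenerate boundary conditions `α₁ y₁(0) + α₂ y₂(0) + α₃ y₁(1) = 0`, `y₂(1) = 0`. -/
theorem statement_19
    (b₁ b₂ : ℝ) (hb₁ : b₁ < 0) (hb₂ : 0 < b₂)
    (Q12 Q21 : ℝ → ℂ)
    (hQ12 : AnalyticOnNhd ℝ Q12 I01) (hQ21 : AnalyticOnNhd ℝ Q21 I01)
    (α₁ α₂ α₃ : ℂ) (hα₂ : α₂ ≠ 0)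
    (a : Fin 2 → Fin 4 → ℂ)
    (ha : a = ![![α₁, α₂, α₃, 0], ![0, 0, 0, 1]]) :
    RootSystemComplete b₁ b₂ Q12 Q21 a ↔ ¬ (∀ x ∈ I01, Q21 x = 0) := by
  subst ha
  exact ⟨fun h hQ => not_rootSystemComplete_of_eq_zero hb₂.ne' hQ h,
    fun hne => rootSystemComplete_of_ne_zero hb₁ hb₂ hQ12 hQ21 hne hα₂⟩
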